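/- Let H = 1/6, let (Ω,F,P) be a probability space, and let X¹, X² : ℝ → Ω → ℝ be two independent centered Gaussian processes, each with covariance C_{1/6}. Let f₁, f₂, f₃, f₄ ∈ C_b^∞(ℝ²) and fix t ≥ 0. Then there exists a constant C > 0, depending only on f₁,…,f₄ (not on n or t), such that sup_{n≥1} Σ_{i₁,i₂,i₃,i₄=0}^{⌊2^{n/2}t⌋−1} | E[ Π_{a=1}^{4} ( Δ_{i_a,n}f_a(X¹,X²) · Δ¹_{i_a,n} · ((Δ²_{i_a,n})² − 2^{−n/3}) ) ] | ≤ C(t + t² + t³ + t⁴). -/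

import Mathlib

open MeasureTheory ProbabilityTheory Filter

noncomputable section

/-- Covariance function of the (two-sided) fractional Brownian motion with Hurst index `H`:
`C_H(t,s) = (|t|^{2H} + |s|^{2H} − |t−s|^{2H})/2`. -/
def covH (H t s : ℝ) : ℝ :=
  (|t| ^ (2 * H) + |s| ^ (2 * H) - |t - s| ^ (2 * H)) / 2

/-- `ρ_H(k) = (1/2)(|k+1|^{2H} + |k−1|^{2H} − 2|k|^{2H})`. -/
def rhoH (H : ℝ) (k : ℤ) : ℝ :=
  (|(k : ℝ) + 1| ^ (2 * H) + |(k : ℝ) - 1| ^ (2 * H) - 2 * |(k : ℝ)| ^ (2 * H)) / 2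

/-- `X` is a centered Gaussian process with covariance function `C` under `P`: every finite
linear combination of values of the process is a centered real Gaussian random variable with
the appropriate variance. -/
def IsCenteredGaussianProcess {Ω : Type*} [MeasurableSpace Ω] (P : Measure Ω)
    (X : ℝ → Ω → ℝ) (C : ℝ → ℝ → ℝ) : Prop :=
  (∀ t, Measurable (X t)) ∧
  ∀ (m : ℕ) (ts : Fin m → ℝ) (c : Fin m → ℝ),
    Measure.map (fun ω => ∑ i, c i * X (ts i) ω) P =
      gaussianReal 0 (Real.toNNReal (∑ i, ∑ j, c i * c j * C (ts i) (ts j)))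

/-- The σ-algebras generated by the two processes `X1` and `X2` are independent under `P`. -/
def IndepProcesses {Ω : Type*} [MeasurableSpace Ω] (P : Measure Ω)
    (X1 X2 : ℝ → Ω → ℝ) : Prop :=
  ProbabilityTheory.Indep
    (⨆ t : ℝ, MeasurableSpace.comap (X1 t) inferInstance)
    (⨆ t : ℝ, MeasurableSpace.comap (X2 t) inferInstance) P

/-- `g` is infinitely differentiable and bounded together with all its derivatives. -/
def CbSmooth {E : Type*} [NormedAddCommGroup E] [NormedSpace ℝ E] (g : E → ℝ) : Prop :=
  (∀ n : ℕ, ContDiff ℝ n g) ∧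
  ∀ k : ℕ, ∃ M : ℝ, ∀ x : E, ‖iteratedFDeriv ℝ k g x‖ ≤ M

/-- `f : ℝ² → ℝ` (in curried form) belongs to `C_b^∞(ℝ²)`. -/
def CbSmooth2 (f : ℝ → ℝ → ℝ) : Prop :=
  CbSmooth fun p : ℝ × ℝ => f p.1 p.2

/-- Partial derivative of `f : ℝ → ℝ → ℝ`, taken `k` times in the first variable and `l` times
in the second variable. -/
def pd (k l : ℕ) (f : ℝ → ℝ → ℝ) (x y : ℝ) : ℝ :=
  iteratedDeriv k (fun u => iteratedDeriv l (fun v => f u v) y) x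

/-- The dyadic point `j·2^{−n/2}`. -/
def dyadicPt (n j : ℕ) : ℝ := (j : ℝ) * (2 : ℝ) ^ (-(n : ℝ) / 2)

/-- The number of dyadic steps `⌊2^{n/2} t⌋`. -/
def nSteps (n : ℕ) (t : ℝ) : ℕ := Nat.floor ((2 : ℝ) ^ ((n : ℝ) / 2) * t)

variable {Ω : Type*}

/-- The increment `X_{(j+1)2^{−n/2}} − X_{j2^{−n/2}}` of the process `X`. -/
def Xincr (X : ℝ → Ω → ℝ) (n j : ℕ) (ω : Ω) : ℝ :=
  X (dyadicPt n (j + 1)) ω - X (dyadicPt n j) ω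

/-- The midpoint evaluation `Δ_{j,n} g(X¹,X²)`. -/
def Xmid (X1 X2 : ℝ → Ω → ℝ) (g : ℝ → ℝ → ℝ) (n j : ℕ) (ω : Ω) : ℝ :=
  g ((X1 (dyadicPt n (j + 1)) ω + X1 (dyadicPt n j) ω) / 2)
    ((X2 (dyadicPt n (j + 1)) ω + X2 (dyadicPt n j) ω) / 2)

section Calculus

variable {E F : Type*} [NormedAddCommGroup E] [NormedSpace ℝ E]
  [NormedAddCommGroup F] [NormedSpace ℝ F]

/-- The derivative of `φ` in the direction `c`. -/
def dirDeriv (c : E) (φ : E → ℝ) : E → ℝ := fun x => fderiv ℝ φ x c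

theorem CbSmooth.continuous {φ : E → ℝ} (hφ : CbSmooth φ) : Continuous φ := (hφ.1 0).continuous

theorem CbSmooth.differentiable {φ : E → ℝ} (hφ : CbSmooth φ) : Differentiable ℝ φ :=
  (hφ.1 1).differentiable (by norm_num)

theorem CbSmooth.exists_bound {φ : E → ℝ} (hφ : CbSmooth φ) : ∃ M, ∀ x, |φ x| ≤ M := by
  obtain ⟨M, hM⟩ := hφ.2 0
  exact ⟨M, fun x => by simpa using hM x⟩

theorem contDiff_fderiv_of_forall {φ : E → ℝ} (hφ : ∀ n : ℕ, ContDiff ℝ n φ) (n : ℕ) :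
    ContDiff ℝ n (fderiv ℝ φ) :=
  (hφ (n + 1)).fderiv_right (by norm_cast)

theorem norm_iteratedFDeriv_dirDeriv_le {φ : E → ℝ} (hφ : ∀ n : ℕ, ContDiff ℝ n φ) (c : E)
    (k : ℕ) (x : E) :
    ‖iteratedFDeriv ℝ k (dirDeriv c φ) x‖ ≤ ‖c‖ * ‖iteratedFDeriv ℝ (k + 1) φ x‖ := by
  rw [← norm_iteratedFDeriv_fderiv]
  exact norm_iteratedFDeriv_clm_apply_const (contDiff_fderiv_of_forall hφ k).contDiffAt le_rfl

theorem CbSmooth.dirDeriv {φ : E → ℝ} (hφ : CbSmooth φ) (c : E) : CbSmooth (dirDeriv c φ) := by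
  refine ⟨fun n => (contDiff_fderiv_of_forall hφ.1 n).clm_apply contDiff_const, fun k => ?_⟩
  obtain ⟨M, hM⟩ := hφ.2 (k + 1)
  exact ⟨‖c‖ * M, fun x => (norm_iteratedFDeriv_dirDeriv_le hφ.1 c k x).trans
    (mul_le_mul_of_nonneg_left (hM x) (norm_nonneg _))⟩

theorem CbSmooth.mul {φ ψ : E → ℝ} (hφ : CbSmooth φ) (hψ : CbSmooth ψ) :
    CbSmooth fun x => φ x * ψ x := by
  refine ⟨fun n => (hφ.1 n).mul (hψ.1 n), fun k => ?_⟩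
  choose M hM using hφ.2
  choose N hN using hψ.2
  refine ⟨∑ i ∈ Finset.range (k + 1), (k.choose i : ℝ) * M i * N (k - i), fun x => ?_⟩
  refine (norm_iteratedFDeriv_mul_le (hφ.1 k) (hψ.1 k) x le_rfl).trans
    (Finset.sum_le_sum fun i _ => ?_)
  have := (norm_nonneg _).trans (hM i x)
  gcongr
  · exact hM i x
  · exact hN (k - i) x

theorem CbSmooth.comp_clm {φ : F → ℝ} (hφ : CbSmooth φ) (g : E →L[ℝ] F) :
    CbSmooth fun x => φ (g x) := by
  refine ⟨fun n => (hφ.1 n).comp g.contDiff, fun k => ?_⟩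
  obtain ⟨M, hM⟩ := hφ.2 k
  refine ⟨M * ‖g‖ ^ k, fun x => ?_⟩
  have h := g.iteratedFDeriv_comp_right (hφ.1 k) x (i := k) le_rfl
  rw [Function.comp_def] at h
  rw [h]
  refine (ContinuousMultilinearMap.norm_compContinuousLinearMap_le _ _).trans ?_
  simpa using mul_le_mul_of_nonneg_right (hM (g x)) (by positivity)

theorem CbSmooth.comp_prodMk {φ : E × F → ℝ} (hφ : CbSmooth φ) (z : F) :
    CbSmooth fun x => φ (x, z) := by
  have h : CbSmooth fun p => φ (p + (0, z)) := by
    refine ⟨fun n => (hφ.1 n).comp (contDiff_id.add contDiff_const), fun k => ?_⟩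
    obtain ⟨M, hM⟩ := hφ.2 k
    exact ⟨M, fun x => by simpa [iteratedFDeriv_comp_add_right] using hM _⟩
  simpa using h.comp_clm (ContinuousLinearMap.inl ℝ E F)

/-- The partial derivatives in the first variable are bounded uniformly in the second one. -/
theorem CbSmooth.exists_uniform_bound {φ : E × F → ℝ} (hφ : CbSmooth φ) (k : ℕ) :
    ∃ K, ∀ z x, ‖iteratedFDeriv ℝ k (fun x => φ (x, z)) x‖ ≤ K := by
  obtain ⟨M, hM⟩ := hφ.2 k
  refine ⟨M * ‖ContinuousLinearMap.inl ℝ E F‖ ^ k, fun z x => ?_⟩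
  have hc : ContDiff ℝ k fun p => φ (p + (0, z)) :=
    (hφ.1 k).comp (contDiff_id.add contDiff_const)
  have h := (ContinuousLinearMap.inl ℝ E F).iteratedFDeriv_comp_right hc x (i := k) le_rfl
  simp only [Function.comp_def, ContinuousLinearMap.inl_apply, Prod.mk_add_mk, add_zero,
    zero_add, iteratedFDeriv_comp_add_right] at h
  rw [h]
  refine (ContinuousMultilinearMap.norm_compContinuousLinearMap_le _ _).trans ?_
  simpa using mul_le_mul_of_nonneg_right (hM (x, z)) (by positivity)

theorem dirDeriv_comp_clm {φ : F → ℝ} (hφ : CbSmooth φ) (g : E →L[ℝ] F) (c : E) :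
    dirDeriv c (fun x => φ (g x)) = fun x => dirDeriv (g c) φ (g x) := by
  funext x
  have h := (hφ.differentiable (g x)).hasFDerivAt.comp x g.hasFDerivAt
  simp only [dirDeriv]
  rw [show (fun x => φ (g x)) = φ ∘ g from rfl, h.fderiv]
  rfl

theorem CbSmooth.abs_dirDeriv_dirDeriv_le {φ : E → ℝ} (hφ : CbSmooth φ) {K : ℝ}
    (hK : ∀ x, ‖iteratedFDeriv ℝ 2 φ x‖ ≤ K) (c₁ c₂ x : E) :
    |_root_.dirDeriv c₂ (_root_.dirDeriv c₁ φ) x| ≤ K * (‖c₁‖ * ‖c₂‖) := by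
  have h₁ := norm_iteratedFDeriv_dirDeriv_le hφ.1 c₁ 1 x
  have h₂ := norm_iteratedFDeriv_dirDeriv_le (hφ.dirDeriv c₁).1 c₂ 0 x
  rw [norm_iteratedFDeriv_zero, Real.norm_eq_abs] at h₂
  calc _ ≤ ‖c₂‖ * (‖c₁‖ * K) := h₂.trans (by gcongr; exact h₁.trans (by gcongr; exact hK x))
    _ = _ := by ring

theorem CbSmooth.abs_dirDeriv_four_le {φ : E → ℝ} (hφ : CbSmooth φ) {K : ℝ}
    (hK : ∀ x, ‖iteratedFDeriv ℝ 4 φ x‖ ≤ K) (c₁ c₂ c₃ c₄ x : E) :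
    |_root_.dirDeriv c₄ (_root_.dirDeriv c₃ (_root_.dirDeriv c₂ (_root_.dirDeriv c₁ φ))) x| ≤
      K * (‖c₁‖ * ‖c₂‖ * (‖c₃‖ * ‖c₄‖)) := by
  have h : ∀ x, ‖iteratedFDeriv ℝ 2 (_root_.dirDeriv c₂ (_root_.dirDeriv c₁ φ)) x‖ ≤
      ‖c₂‖ * (‖c₁‖ * K) := fun x =>
    (norm_iteratedFDeriv_dirDeriv_le (hφ.dirDeriv c₁).1 c₂ 2 x).trans (by
      gcongr
      exact (norm_iteratedFDeriv_dirDeriv_le hφ.1 c₁ 3 x).trans (by gcongr; exact hK x))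
  refine (((hφ.dirDeriv c₁).dirDeriv c₂).abs_dirDeriv_dirDeriv_le h c₃ c₄ x).trans (le_of_eq ?_)
  ring

end Calculus

section GaussianIntegrationByParts

open scoped NNReal

theorem hasDerivAt_gaussianPDFReal_zero (v : ℝ≥0) (x : ℝ) :
    HasDerivAt (gaussianPDFReal 0 v) (-(x / v) * gaussianPDFReal 0 v x) x := by
  have h : HasDerivAt (fun x : ℝ => (√(2 * Real.pi * v))⁻¹ * Real.exp (-(x - 0) ^ 2 / (2 * v)))
      ((√(2 * Real.pi * v))⁻¹ * (Real.exp (-(x - 0) ^ 2 / (2 * v)) *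
        (-(2 * (x - 0)) / (2 * v)))) x := by
    refine (HasDerivAt.exp ?_).const_mul _
    simpa using ((((hasDerivAt_id x).sub_const 0).pow 2).neg).div_const (2 * (v : ℝ))
  rw [gaussianPDFReal_def]
  convert h using 1
  simp only [sub_zero]
  rw [neg_div, neg_div, mul_div_mul_left _ _ (two_ne_zero' ℝ)]
  ring

theorem integrable_gaussianPDFReal_mul_iff {v : ℝ≥0} (hv : v ≠ 0) {f : ℝ → ℝ} :
    Integrable (fun x => gaussianPDFReal 0 v x * f x) ↔ Integrable f (gaussianReal 0 v) := by
  rw [gaussianReal_of_var_ne_zero _ hv,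
    integrable_withDensity_iff_integrable_smul' (measurable_gaussianPDF _ _)
      (ae_of_all _ fun _ => gaussianPDF_lt_top)]
  simp [toReal_gaussianPDF]

/-- Stein's identity for a centered real Gaussian measure. -/
theorem integral_id_mul_gaussianReal {v : ℝ≥0} (hv : v ≠ 0) {φ φ' : ℝ → ℝ}
    (hφ : ∀ s, HasDerivAt φ (φ' s) s)
    (h₁ : Integrable (fun s => s * φ s) (gaussianReal 0 v))
    (h₂ : Integrable φ' (gaussianReal 0 v)) (h₃ : Integrable φ (gaussianReal 0 v)) :
    ∫ s, s * φ s ∂gaussianReal 0 v = v * ∫ s, φ' s ∂gaussianReal 0 v := by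
  rw [← integrable_gaussianPDFReal_mul_iff hv] at h₁ h₂ h₃
  have hv' : (v : ℝ) ≠ 0 := by exact_mod_cast hv
  have key := integral_mul_deriv_eq_deriv_mul_of_integrable (u := φ) (u' := φ')
    (v := gaussianPDFReal 0 v) (v' := fun x => -(x / v) * gaussianPDFReal 0 v x)
    (fun x _ => hφ x) (fun x _ => hasDerivAt_gaussianPDFReal_zero v x)
    (by
      refine (h₁.const_mul (-(v : ℝ)⁻¹)).congr (ae_of_all _ fun x => ?_)
      simp only [Pi.mul_apply]; ring)
    (by simpa only [Pi.mul_def, mul_comm] using h₂)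
    (by simpa only [Pi.mul_def, mul_comm] using h₃)
  rw [integral_gaussianReal_eq_integral_smul hv, integral_gaussianReal_eq_integral_smul hv]
  simp only [smul_eq_mul]
  have e₁ : ∫ x, gaussianPDFReal 0 v x * (x * φ x) =
      -v * ∫ x, φ x * (-(x / v) * gaussianPDFReal 0 v x) := by
    rw [← integral_const_mul]
    congr 1; funext x
    field_simp
  rw [e₁, key]
  simp_rw [mul_comm (φ' _)]
  ring

variable {E : Type*} [NormedAddCommGroup E] [NormedSpace ℝ E] [MeasurableSpace E] [BorelSpace E]
  [CompleteSpace E] [SecondCountableTopology E]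

/-- Gaussian integration by parts: `E[ℓ Φ] = E[∂_c Φ]`, where `c` represents the covariances of
`ℓ` with all continuous linear functionals. -/
theorem integral_dual_mul_eq_integral_lineDeriv (μ : Measure E) [IsGaussian μ]
    (h0 : ∀ L : StrongDual ℝ E, ∫ x, L x ∂μ = 0) {ℓ : StrongDual ℝ E} {c : E}
    (hc : ∀ L : StrongDual ℝ E, L c = ∫ x, ℓ x * L x ∂μ) (hpos : 0 < ℓ c) {Φ Ψ : E → ℝ}
    (hΦc : Continuous Φ) (hΨc : Continuous Ψ)
    (hΦ : ∀ (x : E) (s : ℝ), HasDerivAt (fun s => Φ (x + s • c)) (Ψ (x + s • c)) s)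
    (h₁ : Integrable (fun x => ℓ x * Φ x) μ) (h₂ : Integrable Ψ μ) (h₃ : Integrable Φ μ) :
    ∫ x, ℓ x * Φ x ∂μ = ∫ x, Ψ x ∂μ := by
  set v : ℝ := ℓ c with hv
  set T : E →L[ℝ] E := ContinuousLinearMap.id ℝ E - (v⁻¹ • ℓ).smulRight c with hT
  have hTx : ∀ x, T x + (ℓ x / v) • c = x := fun x => by
    simp [hT, div_eq_inv_mul]
  have hcov : ∀ L₁ L₂ : StrongDual ℝ E, cov[L₁, L₂; μ] = ∫ x, L₁ x * L₂ x ∂μ := fun L₁ L₂ => by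
    simp [covariance, h0]
  have hlaw : HasGaussianLaw (fun x => (ℓ x, T x)) μ :=
    (IsGaussian.hasGaussianLaw_id (μ := μ)).map_fun (ℓ.prod T)
  have hind : IndepFun ℓ T μ := by
    refine hlaw.indepFun_of_covariance_strongDual fun L₁ L₂ => ?_
    have e₁ : L₁ ∘ ℓ = (L₁ 1) • ℓ := by
      funext x
      have := L₁.map_smul (ℓ x) 1
      simpa [mul_comm] using this
    have e₂ : L₂ ∘ T = (L₂.comp T : StrongDual ℝ E) := rfl
    rw [e₁, e₂, covariance_smul_left, hcov, ← hc]
    simp [hT, ← hv, hpos.ne']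
  have hmap := hind.map_prod_eq_prod_map_map (by fun_prop) (by fun_prop)
  have hmℓ : μ.map ℓ = gaussianReal 0 v.toNNReal := by
    rw [IsGaussian.map_eq_gaussianReal, h0, ← covariance_self (by fun_prop), hcov, ← hc]
  have hvn : v.toNNReal ≠ 0 := by simpa using hpos
  have hmp : AEMeasurable (fun x => (ℓ x, T x)) μ := by fun_prop
  set G₁ : ℝ × E → ℝ := fun p => p.1 * Φ (p.2 + (p.1 / v) • c) with hG₁
  set G₂ : ℝ × E → ℝ := fun p => Ψ (p.2 + (p.1 / v) • c) with hG₂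
  set G₃ : ℝ × E → ℝ := fun p => Φ (p.2 + (p.1 / v) • c) with hG₃
  have c₁ : Continuous G₁ := by fun_prop
  have c₂ : Continuous G₂ := by fun_prop
  have c₃ : Continuous G₃ := by fun_prop
  have i₁ : Integrable G₁ ((gaussianReal 0 v.toNNReal).prod (μ.map T)) := by
    rw [← hmℓ, ← hmap, integrable_map_measure c₁.aestronglyMeasurable hmp]
    simpa [Function.comp_def, hG₁, hTx] using h₁
  have i₂ : Integrable G₂ ((gaussianReal 0 v.toNNReal).prod (μ.map T)) := by
    rw [← hmℓ, ← hmap, integrable_map_measure c₂.aestronglyMeasurable hmp]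
    simpa [Function.comp_def, hG₂, hTx] using h₂
  have i₃ : Integrable G₃ ((gaussianReal 0 v.toNNReal).prod (μ.map T)) := by
    rw [← hmℓ, ← hmap, integrable_map_measure c₃.aestronglyMeasurable hmp]
    simpa [Function.comp_def, hG₃, hTx] using h₃
  have hprob : IsProbabilityMeasure (μ.map T) := Measure.isProbabilityMeasure_map (by fun_prop)
  have e₁ : ∫ x, ℓ x * Φ x ∂μ = ∫ p, G₁ p ∂((gaussianReal 0 v.toNNReal).prod (μ.map T)) := by
    rw [← hmℓ, ← hmap, integral_map hmp c₁.aestronglyMeasurable]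
    simp [hG₁, hTx]
  have e₂ : ∫ x, Ψ x ∂μ = ∫ p, G₂ p ∂((gaussianReal 0 v.toNNReal).prod (μ.map T)) := by
    rw [← hmℓ, ← hmap, integral_map hmp c₂.aestronglyMeasurable]
    simp [hG₂, hTx]
  rw [e₁, e₂, integral_prod_symm _ i₁, integral_prod_symm _ i₂]
  refine integral_congr_ae ?_
  filter_upwards [i₁.prod_left_ae, i₂.prod_left_ae, i₃.prod_left_ae] with w w₁ w₂ w₃
  have hd : ∀ s, HasDerivAt (fun s => G₃ (s, w)) (v⁻¹ * G₂ (s, w)) s := fun s => by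
    have := (hΦ w (s / v)).comp s ((hasDerivAt_id s).div_const v)
    simpa [hG₂, hG₃, Function.comp_def, mul_comm] using this
  rw [show (fun s => G₁ (s, w)) = fun s => s * G₃ (s, w) from rfl,
    integral_id_mul_gaussianReal hvn hd w₁ (w₂.const_mul _) w₃, integral_const_mul,
    Real.coe_toNNReal _ hpos.le, mul_inv_cancel_left₀ hpos.ne']

end GaussianIntegrationByParts

section Wick

variable {E : Type*} [NormedAddCommGroup E]

/-- Continuous functions of at most polynomial growth. -/
def PolyGrowth (f : E → ℝ) : Prop :=
  Continuous f ∧ ∃ (C : ℝ) (k : ℕ), ∀ x, |f x| ≤ C * (1 + ‖x‖) ^ k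

theorem PolyGrowth.mul {f g : E → ℝ} (hf : PolyGrowth f) (hg : PolyGrowth g) :
    PolyGrowth fun x => f x * g x := by
  obtain ⟨hf, C, k, hC⟩ := hf
  obtain ⟨hg, D, l, hD⟩ := hg
  refine ⟨hf.mul hg, C * D, k + l, fun x => ?_⟩
  rw [abs_mul, pow_add]
  calc |f x| * |g x| ≤ (C * (1 + ‖x‖) ^ k) * (D * (1 + ‖x‖) ^ l) :=
        mul_le_mul (hC x) (hD x) (abs_nonneg _) ((abs_nonneg _).trans (hC x))
    _ = _ := by ring

theorem PolyGrowth.add {f g : E → ℝ} (hf : PolyGrowth f) (hg : PolyGrowth g) :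
    PolyGrowth fun x => f x + g x := by
  obtain ⟨hf, C, k, hC⟩ := hf
  obtain ⟨hg, D, l, hD⟩ := hg
  refine ⟨hf.add hg, |C| + |D|, k + l, fun x => ?_⟩
  have h1 : 1 ≤ 1 + ‖x‖ := by simp
  have hk : (1 + ‖x‖) ^ k ≤ (1 + ‖x‖) ^ (k + l) := pow_le_pow_right₀ h1 (by omega)
  have hl : (1 + ‖x‖) ^ l ≤ (1 + ‖x‖) ^ (k + l) := pow_le_pow_right₀ h1 (by omega)
  calc |f x + g x| ≤ |f x| + |g x| := abs_add_le _ _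
    _ ≤ C * (1 + ‖x‖) ^ k + D * (1 + ‖x‖) ^ l := add_le_add (hC x) (hD x)
    _ ≤ |C| * (1 + ‖x‖) ^ (k + l) + |D| * (1 + ‖x‖) ^ (k + l) := by
        gcongr <;> exact le_abs_self _
    _ = _ := by ring

theorem polyGrowth_const (r : ℝ) : PolyGrowth fun _ : E => r :=
  ⟨continuous_const, |r|, 0, fun x => by simp⟩

variable [NormedSpace ℝ E]

theorem CbSmooth.polyGrowth {φ : E → ℝ} (hφ : CbSmooth φ) : PolyGrowth φ := by
  obtain ⟨M, hM⟩ := hφ.exists_bound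
  exact ⟨hφ.continuous, M, 0, fun x => by simpa using hM x⟩

theorem polyGrowth_dual (L : StrongDual ℝ E) : PolyGrowth L :=
  ⟨L.continuous, ‖L‖, 1, fun x => (L.le_opNorm x).trans (by
    rw [pow_one]
    gcongr
    simp)⟩

theorem CbSmooth.hasDerivAt_line {φ : E → ℝ} (hφ : CbSmooth φ) (c x : E) (s : ℝ) :
    HasDerivAt (fun s => φ (x + s • c)) (_root_.dirDeriv c φ (x + s • c)) s := by
  have h : HasDerivAt (fun s : ℝ => x + s • c) c s := by
    simpa using ((hasDerivAt_id s).smul_const c).const_add x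
  exact (hφ.differentiable _).hasFDerivAt.comp_hasDerivAt s h

theorem hasDerivAt_dual_line (L : StrongDual ℝ E) (c x : E) (s : ℝ) :
    HasDerivAt (fun s => L (x + s • c)) (L c) s := by
  have h : HasDerivAt (fun s : ℝ => x + s • c) c s := by
    simpa using ((hasDerivAt_id s).smul_const c).const_add x
  exact L.hasFDerivAt.comp_hasDerivAt s h

variable [MeasurableSpace E] [BorelSpace E] [CompleteSpace E] [SecondCountableTopology E]

theorem PolyGrowth.integrable {f : E → ℝ} (hf : PolyGrowth f) (μ : Measure E) [IsGaussian μ] :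
    Integrable f μ := by
  obtain ⟨hf, C, k, hC⟩ := hf
  have hn : MemLp (fun x : E => ‖x‖) (k : ENNReal) μ :=
    (IsGaussian.memLp_id μ (k : ENNReal) (by simp)).norm
  have hm : MemLp (fun x : E => 1 + ‖x‖) (k : ENNReal) μ := (memLp_const (1 : ℝ)).add hn
  have hi : Integrable (fun x : E => (1 + ‖x‖) ^ k) μ := by
    refine hm.integrable_norm_pow'.congr (ae_of_all _ fun x => ?_)
    simp only [Real.norm_eq_abs]
    rw [abs_of_nonneg (by positivity)]
  exact (hi.const_mul C).mono' hf.aestronglyMeasurable (ae_of_all _ hC)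

/-- `c` represents the covariances under `μ` of `ℓ` with all continuous linear functionals,
and `ℓ` has positive variance. -/
def IsCovVec (μ : Measure E) (ℓ : StrongDual ℝ E) (c : E) : Prop :=
  (∀ L : StrongDual ℝ E, L c = ∫ x, ℓ x * L x ∂μ) ∧ 0 < ℓ c

variable {μ : Measure E} [IsGaussian μ]
theorem IsCovVec.integral_mul_eq (h0 : ∀ L : StrongDual ℝ E, ∫ x, L x ∂μ = 0)
    {ℓ : StrongDual ℝ E} {c : E} (h : IsCovVec μ ℓ c) {Φ Ψ : E → ℝ}
    (hΦ : PolyGrowth Φ) (hΨ : PolyGrowth Ψ)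
    (hd : ∀ (x : E) (s : ℝ), HasDerivAt (fun s => Φ (x + s • c)) (Ψ (x + s • c)) s) :
    ∫ x, ℓ x * Φ x ∂μ = ∫ x, Ψ x ∂μ :=
  integral_dual_mul_eq_integral_lineDeriv μ h0 h.1 h.2 hΦ.1 hΨ.1 hd
    (((polyGrowth_dual ℓ).mul hΦ).integrable μ) (hΨ.integrable μ) (hΦ.integrable μ)

theorem IsCovVec.integral_mul_smooth (h0 : ∀ L : StrongDual ℝ E, ∫ x, L x ∂μ = 0)
    {ℓ : StrongDual ℝ E} {c : E} (h : IsCovVec μ ℓ c) {φ : E → ℝ} (hφ : CbSmooth φ) :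
    ∫ x, ℓ x * φ x ∂μ = ∫ x, dirDeriv c φ x ∂μ :=
  h.integral_mul_eq h0 hφ.polyGrowth (hφ.dirDeriv c).polyGrowth (hφ.hasDerivAt_line c)

theorem integral_two_mul_smooth (h0 : ∀ L : StrongDual ℝ E, ∫ x, L x ∂μ = 0)
    {ℓ₁ ℓ₂ : StrongDual ℝ E} {c₁ c₂ : E} (h₁ : IsCovVec μ ℓ₁ c₁) (h₂ : IsCovVec μ ℓ₂ c₂)
    {φ : E → ℝ} (hφ : CbSmooth φ) :
    ∫ x, ℓ₁ x * (ℓ₂ x * φ x) ∂μ =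
      ℓ₂ c₁ * ∫ x, φ x ∂μ + ∫ x, dirDeriv c₂ (dirDeriv c₁ φ) x ∂μ := by
  have g₂ := polyGrowth_dual ℓ₂
  have gφ := hφ.polyGrowth
  have gφ' := (hφ.dirDeriv c₁).polyGrowth
  have i₁ := (polyGrowth_const (ℓ₂ c₁)).mul gφ
  have i₂ := g₂.mul gφ'
  rw [h₁.integral_mul_eq h0 (g₂.mul gφ) (i₁.add i₂) fun x s =>
      (hasDerivAt_dual_line ℓ₂ c₁ x s).mul (hφ.hasDerivAt_line c₁ x s),
    integral_add (i₁.integrable μ) (i₂.integrable μ), integral_const_mul,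
    h₂.integral_mul_smooth h0 (hφ.dirDeriv c₁)]

theorem integral_three_mul_smooth (h0 : ∀ L : StrongDual ℝ E, ∫ x, L x ∂μ = 0)
    {ℓ₁ ℓ₂ ℓ₃ : StrongDual ℝ E} {c₁ c₂ c₃ : E} (h₁ : IsCovVec μ ℓ₁ c₁)
    (h₂ : IsCovVec μ ℓ₂ c₂) (h₃ : IsCovVec μ ℓ₃ c₃) {φ : E → ℝ} (hφ : CbSmooth φ) :
    ∫ x, ℓ₁ x * (ℓ₂ x * (ℓ₃ x * φ x)) ∂μ =
      ℓ₂ c₁ * ∫ x, dirDeriv c₃ φ x ∂μ + ℓ₃ c₁ * ∫ x, dirDeriv c₂ φ x ∂μ +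
      ℓ₃ c₂ * ∫ x, dirDeriv c₁ φ x ∂μ +
      ∫ x, dirDeriv c₃ (dirDeriv c₂ (dirDeriv c₁ φ)) x ∂μ := by
  have g₂ := polyGrowth_dual ℓ₂
  have g₃ := polyGrowth_dual ℓ₃
  have gφ := hφ.polyGrowth
  have gφ' := (hφ.dirDeriv c₁).polyGrowth
  have i₁ := (polyGrowth_const (ℓ₂ c₁)).mul (g₃.mul gφ)
  have i₂ := (polyGrowth_const (ℓ₃ c₁)).mul (g₂.mul gφ)
  have i₃ := g₂.mul (g₃.mul gφ')
  rw [h₁.integral_mul_eq h0 (g₂.mul (g₃.mul gφ)) ((i₁.add i₂).add i₃) fun x s => by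
      refine ((hasDerivAt_dual_line ℓ₂ c₁ x s).mul ((hasDerivAt_dual_line ℓ₃ c₁ x s).mul
        (hφ.hasDerivAt_line c₁ x s))).congr_deriv ?_
      simp only [Pi.mul_apply]
      ring,
    integral_add ((i₁.add i₂).integrable μ) (i₃.integrable μ),
    integral_add (i₁.integrable μ) (i₂.integrable μ), integral_const_mul, integral_const_mul,
    h₃.integral_mul_smooth h0 hφ, h₂.integral_mul_smooth h0 hφ,
    integral_two_mul_smooth h0 h₂ h₃ (hφ.dirDeriv c₁)]
  ring

theorem integral_four_mul_smooth (h0 : ∀ L : StrongDual ℝ E, ∫ x, L x ∂μ = 0)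
    {ℓ₁ ℓ₂ ℓ₃ ℓ₄ : StrongDual ℝ E} {c₁ c₂ c₃ c₄ : E} (h₁ : IsCovVec μ ℓ₁ c₁)
    (h₂ : IsCovVec μ ℓ₂ c₂) (h₃ : IsCovVec μ ℓ₃ c₃) (h₄ : IsCovVec μ ℓ₄ c₄)
    {φ : E → ℝ} (hφ : CbSmooth φ) :
    ∫ x, ℓ₁ x * (ℓ₂ x * (ℓ₃ x * (ℓ₄ x * φ x))) ∂μ =
      (ℓ₂ c₁ * ℓ₄ c₃ + ℓ₃ c₁ * ℓ₄ c₂ + ℓ₄ c₁ * ℓ₃ c₂) * ∫ x, φ x ∂μ +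
      (ℓ₂ c₁ * ∫ x, dirDeriv c₄ (dirDeriv c₃ φ) x ∂μ +
        ℓ₃ c₁ * ∫ x, dirDeriv c₄ (dirDeriv c₂ φ) x ∂μ +
        ℓ₄ c₁ * ∫ x, dirDeriv c₃ (dirDeriv c₂ φ) x ∂μ +
        ℓ₃ c₂ * ∫ x, dirDeriv c₄ (dirDeriv c₁ φ) x ∂μ +
        ℓ₄ c₂ * ∫ x, dirDeriv c₃ (dirDeriv c₁ φ) x ∂μ +
        ℓ₄ c₃ * ∫ x, dirDeriv c₂ (dirDeriv c₁ φ) x ∂μ) +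
      ∫ x, dirDeriv c₄ (dirDeriv c₃ (dirDeriv c₂ (dirDeriv c₁ φ))) x ∂μ := by
  have g₂ := polyGrowth_dual ℓ₂
  have g₃ := polyGrowth_dual ℓ₃
  have g₄ := polyGrowth_dual ℓ₄
  have gφ := hφ.polyGrowth
  have gφ' := (hφ.dirDeriv c₁).polyGrowth
  have i₁ := (polyGrowth_const (ℓ₂ c₁)).mul (g₃.mul (g₄.mul gφ))
  have i₂ := (polyGrowth_const (ℓ₃ c₁)).mul (g₂.mul (g₄.mul gφ))
  have i₃ := (polyGrowth_const (ℓ₄ c₁)).mul (g₂.mul (g₃.mul gφ))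
  have i₄ := g₂.mul (g₃.mul (g₄.mul gφ'))
  rw [h₁.integral_mul_eq h0 (g₂.mul (g₃.mul (g₄.mul gφ))) (((i₁.add i₂).add i₃).add i₄)
      fun x s => by
        refine ((hasDerivAt_dual_line ℓ₂ c₁ x s).mul ((hasDerivAt_dual_line ℓ₃ c₁ x s).mul
          ((hasDerivAt_dual_line ℓ₄ c₁ x s).mul (hφ.hasDerivAt_line c₁ x s)))).congr_deriv ?_
        simp only [Pi.mul_apply]
        ring,
    integral_add (((i₁.add i₂).add i₃).integrable μ) (i₄.integrable μ),
    integral_add ((i₁.add i₂).integrable μ) (i₃.integrable μ),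
    integral_add (i₁.integrable μ) (i₂.integrable μ), integral_const_mul, integral_const_mul,
    integral_const_mul, integral_two_mul_smooth h0 h₃ h₄ hφ,
    integral_two_mul_smooth h0 h₂ h₄ hφ, integral_two_mul_smooth h0 h₂ h₃ hφ,
    integral_three_mul_smooth h0 h₂ h₃ h₄ (hφ.dirDeriv c₁)]
  ring

/-- The sum over all partial matchings of four points of the products of the weights `p` of the
matched pairs and the weights `Q` of the unmatched points. -/
def matchingSum (p : Fin 4 → Fin 4 → ℝ) (Q : Fin 4 → ℝ) : ℝ :=
  p 0 1 * p 2 3 + p 0 2 * p 1 3 + p 0 3 * p 1 2 +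
  (p 0 1 * (Q 2 * Q 3) + p 0 2 * (Q 1 * Q 3) + p 0 3 * (Q 1 * Q 2) +
    p 1 2 * (Q 0 * Q 3) + p 1 3 * (Q 0 * Q 2) + p 2 3 * (Q 0 * Q 1)) +
  Q 0 * Q 1 * (Q 2 * Q 3)

theorem abs_integral_four_mul_smooth_le {F : Type*} [NormedAddCommGroup F] [NormedSpace ℝ F]
    (h0 : ∀ L : StrongDual ℝ E, ∫ x, L x ∂μ = 0) {ℓ : Fin 4 → StrongDual ℝ E} {c : Fin 4 → E}
    (h : ∀ a, IsCovVec μ (ℓ a) (c a)) (y : E →L[ℝ] F) {φ : F → ℝ} (hφ : CbSmooth φ) {K : ℝ}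
    (hK0 : ∀ x, ‖iteratedFDeriv ℝ 0 φ x‖ ≤ K) (hK2 : ∀ x, ‖iteratedFDeriv ℝ 2 φ x‖ ≤ K)
    (hK4 : ∀ x, ‖iteratedFDeriv ℝ 4 φ x‖ ≤ K) :
    |∫ x, ℓ 0 x * (ℓ 1 x * (ℓ 2 x * (ℓ 3 x * φ (y x)))) ∂μ| ≤
      K * matchingSum (fun a b => |ℓ b (c a)|) (fun a => ‖y (c a)‖) := by
  have b0 : |∫ x, φ (y x) ∂μ| ≤ K := by
    simpa using norm_integral_le_of_norm_le_const (μ := μ) (f := fun x => φ (y x))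
      (ae_of_all _ fun x => by simpa using hK0 (y x))
  have b2 : ∀ a b, |∫ x, dirDeriv (y (c b)) (dirDeriv (y (c a)) φ) (y x) ∂μ| ≤
      K * (‖y (c a)‖ * ‖y (c b)‖) := fun a b => by
    simpa using norm_integral_le_of_norm_le_const (μ := μ)
      (f := fun x => dirDeriv (y (c b)) (dirDeriv (y (c a)) φ) (y x))
      (ae_of_all _ fun x => hφ.abs_dirDeriv_dirDeriv_le hK2 _ _ (y x))
  have b4 : |∫ x, dirDeriv (y (c 3)) (dirDeriv (y (c 2)) (dirDeriv (y (c 1))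
      (dirDeriv (y (c 0)) φ))) (y x) ∂μ| ≤
      K * (‖y (c 0)‖ * ‖y (c 1)‖ * (‖y (c 2)‖ * ‖y (c 3)‖)) := by
    simpa using norm_integral_le_of_norm_le_const (μ := μ)
      (f := fun x => dirDeriv (y (c 3)) (dirDeriv (y (c 2)) (dirDeriv (y (c 1))
        (dirDeriv (y (c 0)) φ))) (y x))
      (ae_of_all _ fun x => hφ.abs_dirDeriv_four_le hK4 _ _ _ _ (y x))
  have d1 : ∀ a, CbSmooth (dirDeriv (y (c a)) φ) := fun a => hφ.dirDeriv _
  have d2 : CbSmooth (dirDeriv (y (c 1)) (dirDeriv (y (c 0)) φ)) := (d1 0).dirDeriv _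
  have d3 : CbSmooth (dirDeriv (y (c 2)) (dirDeriv (y (c 1)) (dirDeriv (y (c 0)) φ))) :=
    d2.dirDeriv _
  rw [integral_four_mul_smooth h0 (h 0) (h 1) (h 2) (h 3) (hφ.comp_clm y)]
  simp only [dirDeriv_comp_clm hφ, dirDeriv_comp_clm (d1 _), dirDeriv_comp_clm d2,
    dirDeriv_comp_clm d3]
  have m2 : ∀ (r : ℝ) (a b : Fin 4),
      |r * ∫ x, dirDeriv (y (c b)) (dirDeriv (y (c a)) φ) (y x) ∂μ| ≤
      K * (|r| * (‖y (c a)‖ * ‖y (c b)‖)) := fun r a b => by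
    rw [abs_mul]
    calc _ ≤ |r| * (K * (‖y (c a)‖ * ‖y (c b)‖)) := by gcongr; exact b2 a b
      _ = _ := by ring
  have m0 : ∀ p₁ q₁ p₂ q₂ p₃ q₃ : ℝ,
      |(p₁ * q₁ + p₂ * q₂ + p₃ * q₃) * ∫ x, φ (y x) ∂μ| ≤
      K * (|p₁| * |q₁| + |p₂| * |q₂| + |p₃| * |q₃|) := fun p₁ q₁ p₂ q₂ p₃ q₃ => by
    rw [abs_mul, mul_comm K]
    gcongr
    · refine (abs_add_le _ _).trans (add_le_add ((abs_add_le _ _).trans ?_) ?_) <;>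
        simp [abs_mul]
  have a6 : ∀ r₁ r₂ r₃ r₄ r₅ r₆ : ℝ, |r₁ + r₂ + r₃ + r₄ + r₅ + r₆| ≤
      |r₁| + |r₂| + |r₃| + |r₄| + |r₅| + |r₆| := fun r₁ r₂ r₃ r₄ r₅ r₆ => by
    refine (abs_add_le _ _).trans (add_le_add_left ?_ _)
    refine (abs_add_le _ _).trans (add_le_add_left ?_ _)
    refine (abs_add_le _ _).trans (add_le_add_left ?_ _)
    exact abs_add_three _ _ _
  refine (abs_add_three _ _ _).trans ?_
  refine (add_le_add (add_le_add (m0 _ _ _ _ _ _) ((a6 _ _ _ _ _ _).trans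
    (add_le_add (add_le_add (add_le_add (add_le_add (add_le_add (m2 _ _ _) (m2 _ _ _))
      (m2 _ _ _)) (m2 _ _ _)) (m2 _ _ _)) (m2 _ _ _)))) b4).trans (le_of_eq ?_)
  simp only [matchingSum]
  ring

end Wick

section FourfoldSums

/-- The fourfold sum of `G` over `{0, …, N - 1}⁴`. -/
def sum4 (N : ℕ) (G : ℕ → ℕ → ℕ → ℕ → ℝ) : ℝ :=
  ∑ i ∈ Finset.range N, ∑ j ∈ Finset.range N, ∑ k ∈ Finset.range N, ∑ l ∈ Finset.range N,
    G i j k l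

variable {N : ℕ} {G G' : ℕ → ℕ → ℕ → ℕ → ℝ}

theorem sum4_mono (h : ∀ i < N, ∀ j < N, ∀ k < N, ∀ l < N, G i j k l ≤ G' i j k l) :
    sum4 N G ≤ sum4 N G' :=
  Finset.sum_le_sum fun i hi => Finset.sum_le_sum fun j hj => Finset.sum_le_sum fun k hk =>
    Finset.sum_le_sum fun l hl => h i (Finset.mem_range.1 hi) j (Finset.mem_range.1 hj)
      k (Finset.mem_range.1 hk) l (Finset.mem_range.1 hl)

theorem sum4_add : sum4 N (fun i j k l => G i j k l + G' i j k l) = sum4 N G + sum4 N G' := by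
  simp only [sum4, Finset.sum_add_distrib]

theorem sum4_const_mul (r : ℝ) : sum4 N (fun i j k l => r * G i j k l) = r * sum4 N G := by
  simp only [sum4, Finset.mul_sum]

theorem sum4_swap₁₂ (N : ℕ) (G : ℕ → ℕ → ℕ → ℕ → ℝ) :
    sum4 N G = sum4 N fun i j k l => G j i k l :=
  Finset.sum_comm

theorem sum4_swap₂₃ (N : ℕ) (G : ℕ → ℕ → ℕ → ℕ → ℝ) :
    sum4 N G = sum4 N fun i j k l => G i k j l :=
  Finset.sum_congr rfl fun _ _ => Finset.sum_comm

theorem sum4_swap₃₄ (N : ℕ) (G : ℕ → ℕ → ℕ → ℕ → ℝ) :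
    sum4 N G = sum4 N fun i j k l => G i j l k :=
  Finset.sum_congr rfl fun _ _ => Finset.sum_congr rfl fun _ _ => Finset.sum_comm

theorem sum_range_le_mul {f : ℕ → ℝ} {B : ℝ} (h : ∀ i < N, f i ≤ B) :
    ∑ i ∈ Finset.range N, f i ≤ N * B := by
  simpa using Finset.sum_le_card_nsmul (Finset.range N) f B fun i hi =>
    h i (Finset.mem_range.1 hi)

theorem sum4_le_of_inner {g : ℕ → ℕ → ℕ → ℝ} {r : ℝ}
    (h₁ : ∀ i < N, ∀ j < N, ∀ k < N, ∑ l ∈ Finset.range N, G i j k l ≤ g i j k)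
    (h₂ : ∀ i < N, ∀ j < N, ∑ k ∈ Finset.range N, g i j k ≤ r) :
    sum4 N G ≤ N * (N * r) :=
  sum_range_le_mul fun i hi => sum_range_le_mul fun j hj =>
    (Finset.sum_le_sum fun k hk => h₁ i hi j hj k (Finset.mem_range.1 hk)).trans (h₂ i hi j hj)

variable {p q : ℕ → ℕ → ℝ} {v A R : ℝ}

theorem sum4_pair_mul_pair_le (hp : ∀ i j, 0 ≤ p i j)
    (hA : ∀ i < N, ∑ j ∈ Finset.range N, p i j ≤ A) :
    sum4 N (fun i j k l => p i j * p k l) ≤ (N * A) ^ 2 := by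
  rcases Nat.eq_zero_or_pos N with rfl | hN
  · simp [sum4]
  have hA0 : 0 ≤ A := (Finset.sum_nonneg fun j _ => hp 0 j).trans (hA 0 hN)
  rw [sum4_swap₂₃, sum4_swap₃₄]
  refine (sum4_le_of_inner (g := fun i k l => p k l * A) (r := A * A)
    (fun i hi k hk l hl => ?_) fun i hi k hk => ?_).trans (le_of_eq (by ring))
  · rw [← Finset.sum_mul, mul_comm]
    exact mul_le_mul_of_nonneg_left (hA i hi) (hp _ _)
  · rw [← Finset.sum_mul]
    exact mul_le_mul_of_nonneg_right (hA k hk) hA0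

theorem sum4_pair_mul_le (hp : ∀ i j, 0 ≤ p i j) (hq : ∀ i j, 0 ≤ q i j)
    (hA : ∀ i < N, ∑ j ∈ Finset.range N, p i j ≤ A)
    (hv : ∀ i < N, ∀ j < N, q i j ≤ v)
    (hR : ∀ j < N, ∑ i ∈ Finset.range N, q i j ≤ R)
    (hR' : ∑ i ∈ Finset.range N, q i i ≤ R) :
    sum4 N (fun i j k l => p i j * ((q k i + q k j + q k k + q k l) *
      (q l i + q l j + q l k + q l l))) ≤ 16 * N ^ 2 * A * R * v := by
  rcases Nat.eq_zero_or_pos N with rfl | hN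
  · simp [sum4]
  have hv0 : 0 ≤ v := (hq 0 0).trans (hv 0 hN 0 hN)
  have hR0 : 0 ≤ R := (Finset.sum_nonneg fun j _ => hq j j).trans hR'
  rw [sum4_swap₃₄, sum4_swap₂₃]
  refine (sum4_le_of_inner (g := fun i _ j => p i j * (4 * R * (4 * v)))
    (r := A * (4 * R * (4 * v))) (fun i hi l hl j hj => ?_) fun i hi l hl => ?_).trans
    (le_of_eq (by ring))
  · rw [← Finset.mul_sum]
    refine mul_le_mul_of_nonneg_left ?_ (hp i j)
    calc _ ≤ ∑ k ∈ Finset.range N, (q k i + q k j + q k k + q k l) * (4 * v) := by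
          refine Finset.sum_le_sum fun k hk => mul_le_mul_of_nonneg_left ?_ ?_
          · linarith [hv l hl i hi, hv l hl j hj, hv l hl k (Finset.mem_range.1 hk), hv l hl l hl]
          · linarith [hq k i, hq k j, hq k k, hq k l]
      _ ≤ _ := by
          rw [← Finset.sum_mul]
          refine mul_le_mul_of_nonneg_right ?_ (by positivity)
          simp only [Finset.sum_add_distrib]
          linarith [hR i hi, hR j hj, hR l hl]
  · rw [← Finset.sum_mul]
    exact mul_le_mul_of_nonneg_right (hA i hi) (by positivity)

theorem sum4_mul_le (hq : ∀ i j, 0 ≤ q i j) (hv : ∀ i < N, ∀ j < N, q i j ≤ v)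
    (hR : ∀ j < N, ∑ i ∈ Finset.range N, q i j ≤ R)
    (hR' : ∑ i ∈ Finset.range N, q i i ≤ R) :
    sum4 N (fun i j k l => (q i i + q i j + q i k + q i l) * (q j i + q j j + q j k + q j l) *
      ((q k i + q k j + q k k + q k l) * (q l i + q l j + q l k + q l l))) ≤
      256 * N ^ 2 * R ^ 2 * v ^ 2 := by
  rcases Nat.eq_zero_or_pos N with rfl | hN
  · simp [sum4]
  have hv0 : 0 ≤ v := (hq 0 0).trans (hv 0 hN 0 hN)
  have hR0 : 0 ≤ R := (Finset.sum_nonneg fun j _ => hq j j).trans hR'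
  have hQ0 : ∀ a i j k l, 0 ≤ q a i + q a j + q a k + q a l := fun a i j k l => by
    linarith [hq a i, hq a j, hq a k, hq a l]
  have hQ4 : ∀ a < N, ∀ i < N, ∀ j < N, ∀ k < N, ∀ l < N,
      q a i + q a j + q a k + q a l ≤ 4 * v := fun a ha i hi j hj k hk l hl => by
    linarith [hv a ha i hi, hv a ha j hj, hv a ha k hk, hv a ha l hl]
  have hsplit : sum4 N (fun i j k l =>
      (q i i + q i j + q i k + q i l) * (q j i + q j j + q j k + q j l) *
      ((q k i + q k j + q k k + q k l) * (q l i + q l j + q l k + q l l))) ≤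
      sum4 N (fun i j k l => 16 * v ^ 2 *
          ((q i i + q i k + q i l) * (q j i + q j j + q j k + q j l)) +
        16 * v ^ 2 * (q i j * (q k i + q k j + q k k + q k l))) := by
    refine sum4_mono fun i hi j hj k hk l hl => ?_
    have e : (q i i + q i j + q i k + q i l) * (q j i + q j j + q j k + q j l) *
        ((q k i + q k j + q k k + q k l) * (q l i + q l j + q l k + q l l)) =
        (q i i + q i k + q i l) * (q j i + q j j + q j k + q j l) *
          ((q k i + q k j + q k k + q k l) * (q l i + q l j + q l k + q l l)) +
        q i j * (q k i + q k j + q k k + q k l) *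
          ((q j i + q j j + q j k + q j l) * (q l i + q l j + q l k + q l l)) := by ring
    have hl4 := hQ4 l hl i hi j hj k hk l hl
    have h₁ : (q k i + q k j + q k k + q k l) * (q l i + q l j + q l k + q l l) ≤
        4 * v * (4 * v) :=
      mul_le_mul (hQ4 k hk i hi j hj k hk l hl) hl4 (hQ0 _ _ _ _ _) (by positivity)
    have h₂ : (q j i + q j j + q j k + q j l) * (q l i + q l j + q l k + q l l) ≤
        4 * v * (4 * v) :=
      mul_le_mul (hQ4 j hj i hi j hj k hk l hl) hl4 (hQ0 _ _ _ _ _) (by positivity)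
    have h₃ : 0 ≤ (q i i + q i k + q i l) * (q j i + q j j + q j k + q j l) :=
      mul_nonneg (by linarith [hq i i, hq i k, hq i l]) (hQ0 _ _ _ _ _)
    have h₄ : 0 ≤ q i j * (q k i + q k j + q k k + q k l) := mul_nonneg (hq _ _) (hQ0 _ _ _ _ _)
    rw [e]
    linarith [mul_le_mul_of_nonneg_left h₁ h₃, mul_le_mul_of_nonneg_left h₂ h₄]
  have hfirst : sum4 N (fun i j k l =>
      (q i i + q i k + q i l) * (q j i + q j j + q j k + q j l)) ≤ N * (N * (3 * R * (4 * R))) := by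
    rw [sum4_swap₂₃, sum4_swap₁₂, sum4_swap₃₄, sum4_swap₂₃]
    refine sum4_le_of_inner (g := fun k l i => (q i i + q i k + q i l) * (4 * R))
      (fun k hk l hl i hi => ?_) fun k hk l hl => ?_
    · rw [← Finset.mul_sum]
      refine mul_le_mul_of_nonneg_left ?_ (by linarith [hq i i, hq i k, hq i l])
      simp only [Finset.sum_add_distrib]
      linarith [hR i hi, hR k hk, hR l hl]
    · rw [← Finset.sum_mul]
      refine mul_le_mul_of_nonneg_right ?_ (by positivity)
      simp only [Finset.sum_add_distrib]
      linarith [hR k hk, hR l hl]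
  have hsecond : sum4 N (fun i j k l => q i j * (q k i + q k j + q k k + q k l)) ≤
      N * (N * (R * (4 * R))) := by
    rw [sum4_swap₁₂, sum4_swap₃₄, sum4_swap₂₃]
    refine sum4_le_of_inner (g := fun j _ i => q i j * (4 * R))
      (fun j hj l hl i hi => ?_) fun j hj l hl => ?_
    · rw [← Finset.mul_sum]
      refine mul_le_mul_of_nonneg_left ?_ (hq i j)
      simp only [Finset.sum_add_distrib]
      linarith [hR i hi, hR j hj, hR l hl]
    · rw [← Finset.sum_mul]
      exact mul_le_mul_of_nonneg_right (hR j hj) (by positivity)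
  refine hsplit.trans ?_
  rw [sum4_add, sum4_const_mul, sum4_const_mul]
  have hv2 : 0 ≤ 16 * v ^ 2 := by positivity
  linarith [mul_le_mul_of_nonneg_left hfirst hv2, mul_le_mul_of_nonneg_left hsecond hv2]

theorem sum4_matchingSum_le (hp : ∀ i j, 0 ≤ p i j) (hq : ∀ i j, 0 ≤ q i j)
    (hA : ∀ i < N, ∑ j ∈ Finset.range N, p i j ≤ A)
    (hv : ∀ i < N, ∀ j < N, q i j ≤ v)
    (hR : ∀ j < N, ∑ i ∈ Finset.range N, q i j ≤ R)
    (hR' : ∑ i ∈ Finset.range N, q i i ≤ R) :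
    sum4 N (fun i j k l => matchingSum (fun a b => p (![i, j, k, l] a) (![i, j, k, l] b))
      (fun a => ∑ b, q (![i, j, k, l] a) (![i, j, k, l] b))) ≤
      3 * (N * A) ^ 2 + 96 * N ^ 2 * A * R * v + 256 * N ^ 2 * R ^ 2 * v ^ 2 := by
  have hpp := sum4_pair_mul_pair_le hp hA
  have hpq := sum4_pair_mul_le hp hq hA hv hR hR'
  have hqq := sum4_mul_le hq hv hR hR'
  have hcongr : ∀ {G G' : ℕ → ℕ → ℕ → ℕ → ℝ} {B : ℝ}, sum4 N G ≤ B →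
      (∀ i j k l, G' i j k l = G i j k l) → sum4 N G' ≤ B := fun h h' => by
    simpa only [sum4, h'] using h
  simp only [matchingSum, Fin.sum_univ_four, sum4_add]
  simp only [Fin.isValue, Matrix.cons_val]
  have t₁ := hpp
  have t₂ := (sum4_swap₂₃ N (fun i j k l => p i k * p j l)).trans_le hpp
  have t₃ : sum4 N (fun i j k l => p i l * p j k) ≤ (N * A) ^ 2 := by
    rw [sum4_swap₃₄, sum4_swap₂₃]
    exact hpp
  have s₁ := hpq
  have s₂ : sum4 N (fun i j k l => p i k * ((q j i + q j j + q j k + q j l) *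
      (q l i + q l j + q l k + q l l))) ≤ 16 * N ^ 2 * A * R * v := by
    rw [sum4_swap₂₃]
    exact hcongr hpq fun _ _ _ _ => by ring
  have s₃ : sum4 N (fun i j k l => p i l * ((q j i + q j j + q j k + q j l) *
      (q k i + q k j + q k k + q k l))) ≤ 16 * N ^ 2 * A * R * v := by
    rw [sum4_swap₃₄, sum4_swap₂₃]
    exact hcongr hpq fun _ _ _ _ => by ring
  have s₄ : sum4 N (fun i j k l => p j k * ((q i i + q i j + q i k + q i l) *
      (q l i + q l j + q l k + q l l))) ≤ 16 * N ^ 2 * A * R * v := by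
    rw [sum4_swap₁₂, sum4_swap₂₃]
    exact hcongr hpq fun _ _ _ _ => by ring
  have s₅ : sum4 N (fun i j k l => p j l * ((q i i + q i j + q i k + q i l) *
      (q k i + q k j + q k k + q k l))) ≤ 16 * N ^ 2 * A * R * v := by
    rw [sum4_swap₁₂, sum4_swap₃₄, sum4_swap₂₃]
    exact hcongr hpq fun _ _ _ _ => by ring
  have s₆ : sum4 N (fun i j k l => p k l * ((q i i + q i j + q i k + q i l) *
      (q j i + q j j + q j k + q j l))) ≤ 16 * N ^ 2 * A * R * v := by
    rw [sum4_swap₂₃, sum4_swap₁₂, sum4_swap₃₄, sum4_swap₂₃]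
    exact hcongr hpq fun _ _ _ _ => by ring
  linarith

end FourfoldSums

section CubeRootCovariance

/-- The increments of `m ↦ m ^ (1 / 3)`. -/
def cbrtIncr (m : ℕ) : ℝ := ((m : ℝ) + 1) ^ (1 / 3 : ℝ) - (m : ℝ) ^ (1 / 3 : ℝ)

theorem cbrtIncr_nonneg (m : ℕ) : 0 ≤ cbrtIncr m :=
  sub_nonneg.2 (Real.rpow_le_rpow (by positivity) (by linarith) (by norm_num))

theorem cbrtIncr_zero : cbrtIncr 0 = 1 := by
  simp [cbrtIncr]

theorem cbrtIncr_succ_le (m : ℕ) : cbrtIncr (m + 1) ≤ cbrtIncr m := by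
  have h := (Real.concaveOn_rpow (p := (1 / 3 : ℝ)) (by norm_num) (by norm_num)).2
    (show (m : ℝ) ∈ Set.Ici 0 from Set.mem_Ici.2 (by positivity))
    (show (m : ℝ) + 2 ∈ Set.Ici 0 from Set.mem_Ici.2 (by positivity))
    (show (0 : ℝ) ≤ 1 / 2 by norm_num) (show (0 : ℝ) ≤ 1 / 2 by norm_num) (by norm_num)
  have e : (1 / 2 : ℝ) • (m : ℝ) + (1 / 2 : ℝ) • ((m : ℝ) + 2) = m + 1 := by
    simp only [smul_eq_mul]; ring
  simp only [e] at h
  simp only [smul_eq_mul] at h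
  have e' : ((m + 1 : ℕ) : ℝ) + 1 = m + 2 := by push_cast; ring
  simp only [cbrtIncr, e']
  push_cast
  linarith

theorem cbrtIncr_le_one (m : ℕ) : cbrtIncr m ≤ 1 := by
  rw [← cbrtIncr_zero]
  exact antitone_nat_of_succ_le cbrtIncr_succ_le (Nat.zero_le m)

theorem sum_cbrtIncr (M : ℕ) : ∑ m ∈ Finset.range M, cbrtIncr m = (M : ℝ) ^ (1 / 3 : ℝ) := by
  have := Finset.sum_range_sub (fun m : ℕ => (m : ℝ) ^ (1 / 3 : ℝ)) M
  simpa [cbrtIncr] using this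

theorem sum_cbrtIncr_sub_succ_le (M : ℕ) :
    ∑ m ∈ Finset.range M, (cbrtIncr m - cbrtIncr (m + 1)) ≤ 1 := by
  rw [Finset.sum_range_sub' cbrtIncr M, cbrtIncr_zero]
  linarith [cbrtIncr_nonneg M]

/-- The covariance of an increment over `[i, i + 1]` with the value at `k`. -/
def covIncr (i k : ℕ) : ℝ := covH (1 / 6) ((i : ℝ) + 1) k - covH (1 / 6) i k

theorem covH_mul_right {h : ℝ} (hh : 0 ≤ h) (s t : ℝ) :
    covH (1 / 6) (s * h) (t * h) = h ^ (1 / 3 : ℝ) * covH (1 / 6) s t := by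
  have e : (2 * (1 / 6) : ℝ) = 1 / 3 := by norm_num
  simp only [covH, ← sub_mul, abs_mul, abs_of_nonneg hh, e]
  rw [Real.mul_rpow (abs_nonneg _) hh, Real.mul_rpow (abs_nonneg _) hh,
    Real.mul_rpow (abs_nonneg _) hh]
  ring

theorem covIncr_add (k m : ℕ) : covIncr (k + m) k = (cbrtIncr (k + m) - cbrtIncr m) / 2 := by
  have e : (2 * (1 / 6) : ℝ) = 1 / 3 := by norm_num
  have h1 : |(k : ℝ) + m + 1| = k + m + 1 := abs_of_nonneg (by positivity)
  have h2 : |(k : ℝ) + m + 1 - k| = m + 1 := by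
    rw [show (k : ℝ) + m + 1 - k = m + 1 by ring]; exact abs_of_nonneg (by positivity)
  have h3 : |(k : ℝ) + m - k| = m := by
    rw [show (k : ℝ) + m - k = m by ring]; exact abs_of_nonneg (by positivity)
  have h4 : |(k : ℝ) + m| = k + m := abs_of_nonneg (by positivity)
  simp only [covIncr, covH, cbrtIncr, e]
  push_cast
  rw [h1, h2, h3, h4]
  ring

theorem covIncr_of_lt (i m : ℕ) : covIncr i (i + 1 + m) = (cbrtIncr i + cbrtIncr m) / 2 := by
  have e : (2 * (1 / 6) : ℝ) = 1 / 3 := by norm_num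
  have h1 : |(i : ℝ) + 1| = i + 1 := abs_of_nonneg (by positivity)
  have h2 : |(i : ℝ) + 1 - (i + 1 + m)| = m := by
    rw [show (i : ℝ) + 1 - (i + 1 + m) = -m by ring, abs_neg]; exact abs_of_nonneg (by positivity)
  have h3 : |(i : ℝ) - (i + 1 + m)| = m + 1 := by
    rw [show (i : ℝ) - (i + 1 + m) = -(m + 1) by ring, abs_neg]
    exact abs_of_nonneg (by positivity)
  have h4 : |(i : ℝ)| = i := abs_of_nonneg (by positivity)
  simp only [covIncr, covH, cbrtIncr, e]
  push_cast
  rw [h1, h2, h3, h4]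
  ring

theorem abs_covIncr_le_one (i k : ℕ) : |covIncr i k| ≤ 1 := by
  rcases le_or_gt k i with h | h
  · obtain ⟨m, rfl⟩ := Nat.exists_eq_add_of_le h
    rw [covIncr_add, abs_le]
    constructor <;>
      linarith [cbrtIncr_nonneg m, cbrtIncr_nonneg (k + m), cbrtIncr_le_one m,
        cbrtIncr_le_one (k + m)]
  · obtain ⟨m, rfl⟩ := Nat.exists_eq_add_of_le h
    rw [Nat.succ_eq_add_one, covIncr_of_lt, abs_le]
    constructor <;>
      linarith [cbrtIncr_nonneg m, cbrtIncr_nonneg i, cbrtIncr_le_one m, cbrtIncr_le_one i]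

theorem sum_abs_covIncr_le {N k : ℕ} (hk : k ≤ N) :
    ∑ i ∈ Finset.range N, |covIncr i k| ≤ 3 / 2 * (N : ℝ) ^ (1 / 3 : ℝ) := by
  obtain ⟨M, rfl⟩ := Nat.exists_eq_add_of_le hk
  have below : ∑ i ∈ Finset.range k, |covIncr i k| ≤
      ∑ i ∈ Finset.range k, (cbrtIncr i + cbrtIncr (k - 1 - i)) / 2 := by
    refine Finset.sum_le_sum fun i hi => le_of_eq ?_
    obtain ⟨m, rfl⟩ := Nat.exists_eq_add_of_le (Finset.mem_range.1 hi)
    rw [Nat.succ_eq_add_one, covIncr_of_lt, show i + 1 + m - 1 - i = m by omega]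
    exact abs_of_nonneg (by linarith [cbrtIncr_nonneg m, cbrtIncr_nonneg i])
  have above : ∑ m ∈ Finset.range M, |covIncr (k + m) k| ≤
      ∑ m ∈ Finset.range M, (cbrtIncr (k + m) + cbrtIncr m) / 2 := by
    refine Finset.sum_le_sum fun m _ => ?_
    rw [covIncr_add, abs_le]
    constructor <;> linarith [cbrtIncr_nonneg m, cbrtIncr_nonneg (k + m)]
  have total := Finset.sum_range_add cbrtIncr k M
  rw [sum_cbrtIncr, sum_cbrtIncr] at total
  rw [← Finset.sum_div, Finset.sum_add_distrib, Finset.sum_range_reflect, sum_cbrtIncr] at below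
  rw [← Finset.sum_div, Finset.sum_add_distrib, sum_cbrtIncr] at above
  have h1 : (k : ℝ) ^ (1 / 3 : ℝ) ≤ ((k + M : ℕ) : ℝ) ^ (1 / 3 : ℝ) :=
    Real.rpow_le_rpow (by positivity) (by push_cast; linarith [(M.cast_nonneg : (0 : ℝ) ≤ M)])
      (by norm_num)
  have h2 : (M : ℝ) ^ (1 / 3 : ℝ) ≤ ((k + M : ℕ) : ℝ) ^ (1 / 3 : ℝ) :=
    Real.rpow_le_rpow (by positivity) (by push_cast; linarith [(k.cast_nonneg : (0 : ℝ) ≤ k)])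
      (by norm_num)
  rw [Finset.sum_range_add]
  linarith

/-- The covariance of the increments over `[i, i + 1]` and `[j, j + 1]`. -/
def covIncrIncr (i j : ℕ) : ℝ := covIncr i (j + 1) - covIncr i j

theorem covIncrIncr_self (i : ℕ) : covIncrIncr i i = 1 := by
  have h1 := covIncr_of_lt i 0
  have h2 := covIncr_add i 0
  simp only [add_zero, cbrtIncr_zero] at h1 h2
  rw [covIncrIncr, h1, h2]
  ring

theorem covIncrIncr_of_lt (i m : ℕ) :
    covIncrIncr i (i + 1 + m) = -((cbrtIncr m - cbrtIncr (m + 1)) / 2) := by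
  rw [covIncrIncr, covIncr_of_lt, add_assoc (i + 1) m 1, covIncr_of_lt]
  ring

theorem covIncrIncr_of_gt (j m : ℕ) :
    covIncrIncr (j + 1 + m) j = -((cbrtIncr m - cbrtIncr (m + 1)) / 2) := by
  rw [covIncrIncr, covIncr_add, add_assoc j 1 m, covIncr_add, add_comm 1 m]
  ring

theorem sum_abs_covIncrIncr_le (N i : ℕ) : ∑ j ∈ Finset.range N, |covIncrIncr i j| ≤ 2 := by
  have hd : ∀ m, 0 ≤ (cbrtIncr m - cbrtIncr (m + 1)) / 2 := fun m => by
    linarith [cbrtIncr_succ_le m]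
  have below : ∑ j ∈ Finset.range i, |covIncrIncr i j| ≤ 1 / 2 := by
    rw [← Finset.sum_range_reflect]
    calc ∑ m ∈ Finset.range i, |covIncrIncr i (i - 1 - m)|
        = ∑ m ∈ Finset.range i, (cbrtIncr m - cbrtIncr (m + 1)) / 2 := by
          refine Finset.sum_congr rfl fun m hm => ?_
          obtain ⟨j, rfl⟩ := Nat.exists_eq_add_of_le (Finset.mem_range.1 hm)
          rw [Nat.succ_eq_add_one, show m + 1 + j - 1 - m = j by omega,
            show m + 1 + j = j + 1 + m by omega, covIncrIncr_of_gt, abs_neg, abs_of_nonneg (hd m)]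
      _ ≤ 1 / 2 := by
          rw [← Finset.sum_div]
          linarith [sum_cbrtIncr_sub_succ_le i]
  have above : ∑ m ∈ Finset.range N, |covIncrIncr i (i + 1 + m)| ≤ 1 / 2 := by
    simp only [covIncrIncr_of_lt, abs_neg, abs_of_nonneg (hd _)]
    rw [← Finset.sum_div]
    linarith [sum_cbrtIncr_sub_succ_le N]
  have hle : ∑ j ∈ Finset.range N, |covIncrIncr i j| ≤
      ∑ j ∈ Finset.range (i + 1 + N), |covIncrIncr i j| :=
    Finset.sum_le_sum_of_subset_of_nonneg
      (Finset.range_mono (by omega)) fun _ _ _ => abs_nonneg _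
  rw [Finset.sum_range_add, Finset.sum_range_succ, covIncrIncr_self, abs_one] at hle
  linarith

/-- The covariance of an increment over `[i, i + 1]` with the midpoint of the values at
`j` and `j + 1`. -/
def covIncrMid (i j : ℕ) : ℝ := (covIncr i (j + 1) + covIncr i j) / 2

theorem abs_covIncrMid_le (i j : ℕ) :
    |covIncrMid i j| ≤ (|covIncr i (j + 1)| + |covIncr i j|) / 2 := by
  rw [covIncrMid, abs_div, abs_two]
  have := abs_add_le (covIncr i (j + 1)) (covIncr i j)
  linarith

theorem abs_covIncrMid_le_one (i j : ℕ) : |covIncrMid i j| ≤ 1 := by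
  linarith [abs_covIncrMid_le i j, abs_covIncr_le_one i (j + 1), abs_covIncr_le_one i j]

theorem sum_abs_covIncrMid_le {N j : ℕ} (hj : j < N) :
    ∑ i ∈ Finset.range N, |covIncrMid i j| ≤ 3 / 2 * (N : ℝ) ^ (1 / 3 : ℝ) := by
  calc ∑ i ∈ Finset.range N, |covIncrMid i j|
      ≤ ∑ i ∈ Finset.range N, (|covIncr i (j + 1)| + |covIncr i j|) / 2 :=
        Finset.sum_le_sum fun i _ => abs_covIncrMid_le i j
    _ ≤ 3 / 2 * (N : ℝ) ^ (1 / 3 : ℝ) := by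
        rw [← Finset.sum_div, Finset.sum_add_distrib]
        linarith [sum_abs_covIncr_le (show j + 1 ≤ N from hj), sum_abs_covIncr_le hj.le]

theorem sum_abs_covIncrMid_self_le (N : ℕ) :
    ∑ i ∈ Finset.range N, |covIncrMid i i| ≤ 3 / 2 * (N : ℝ) ^ (1 / 3 : ℝ) := by
  have h : ∀ i, |covIncrMid i i| = cbrtIncr i / 2 := fun i => by
    have h1 := covIncr_of_lt i 0
    have h2 := covIncr_add i 0
    simp only [add_zero, cbrtIncr_zero] at h1 h2
    rw [covIncrMid, h1, h2, show ((cbrtIncr i + 1) / 2 + (cbrtIncr i - 1) / 2) / 2 =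
      cbrtIncr i / 2 by ring]
    exact abs_of_nonneg (by linarith [cbrtIncr_nonneg i])
  simp only [h]
  rw [← Finset.sum_div, sum_cbrtIncr]
  have : 0 ≤ (N : ℝ) ^ (1 / 3 : ℝ) := by positivity
  linarith

end CubeRootCovariance

section ProcessLaw

/-- The law of the process `X` at the points `0, 2^{−n/2}, …, N 2^{−n/2}`. -/
def gridVec (X : ℝ → Ω → ℝ) (n N : ℕ) (ω : Ω) : Fin (N + 1) → ℝ :=
  fun k => X (dyadicPt n k) ω

/-- The coordinate of a vector on the grid which corresponds to the grid point `k`. -/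
def gridCoord (N k : ℕ) : StrongDual ℝ (Fin (N + 1) → ℝ) :=
  ContinuousLinearMap.proj (Fin.ofNat (N + 1) k)

/-- The increment over `[i, i + 1]` of a vector on the grid. -/
def gridIncr (N i : ℕ) : StrongDual ℝ (Fin (N + 1) → ℝ) := gridCoord N (i + 1) - gridCoord N i

/-- The midpoint of the values at `i` and `i + 1` of a vector on the grid. -/
def gridMid (N i : ℕ) : StrongDual ℝ (Fin (N + 1) → ℝ) :=
  (2⁻¹ : ℝ) • (gridCoord N (i + 1) + gridCoord N i)

/-- The variance `2^{−n/6}` of the increments over the steps of length `2^{−n/2}`. -/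
def stepVar (n : ℕ) : ℝ := ((2 : ℝ) ^ (-(n : ℝ) / 2)) ^ (1 / 3 : ℝ)

theorem stepVar_pos (n : ℕ) : 0 < stepVar n := by
  unfold stepVar; positivity

theorem gridCoord_gridVec (X : ℝ → Ω → ℝ) (n : ℕ) {N k : ℕ} (hk : k ≤ N) (ω : Ω) :
    gridCoord N k (gridVec X n N ω) = X (dyadicPt n k) ω := by
  have : k % (N + 1) = k := Nat.mod_eq_of_lt (by omega)
  simp [gridCoord, gridVec, Fin.ofNat, this]

theorem gridIncr_gridVec (X : ℝ → Ω → ℝ) (n : ℕ) {N i : ℕ} (hi : i < N) (ω : Ω) :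
    gridIncr N i (gridVec X n N ω) = Xincr X n i ω := by
  rw [gridIncr, sub_apply, gridCoord_gridVec X n (show i + 1 ≤ N from hi),
    gridCoord_gridVec X n hi.le, Xincr]

theorem gridMid_gridVec (X : ℝ → Ω → ℝ) (n : ℕ) {N i : ℕ} (hi : i < N) (ω : Ω) :
    gridMid N i (gridVec X n N ω) = (X (dyadicPt n (i + 1)) ω + X (dyadicPt n i) ω) / 2 := by
  rw [gridMid, smul_apply, add_apply,
    gridCoord_gridVec X n (show i + 1 ≤ N from hi), gridCoord_gridVec X n hi.le, smul_eq_mul]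
  ring

variable [MeasurableSpace Ω] {P : Measure Ω} {X : ℝ → Ω → ℝ}

theorem measurable_gridVec (hX : ∀ t, Measurable (X t)) (n N : ℕ) :
    Measurable (gridVec X n N) :=
  measurable_pi_lambda _ fun _ => hX _

theorem dual_pi_eq_sum {m : ℕ} (L : StrongDual ℝ (Fin m → ℝ)) (x : Fin m → ℝ) :
    L x = ∑ k, L (Pi.single k 1) * x k := by
  conv_lhs => rw [pi_eq_sum_univ' x, map_sum]
  refine Finset.sum_congr rfl fun k _ => ?_
  rw [map_smul, smul_eq_mul, mul_comm]

theorem sum_sum_dual_pi {m : ℕ} (L : StrongDual ℝ (Fin m → ℝ)) (C : Fin m → Fin m → ℝ) :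
    ∑ i, ∑ j, L (Pi.single i 1) * L (Pi.single j 1) * C i j = L fun i => L (C i) := by
  rw [dual_pi_eq_sum L]
  refine Finset.sum_congr rfl fun i _ => ?_
  rw [dual_pi_eq_sum L (C i), Finset.mul_sum]
  exact Finset.sum_congr rfl fun j _ => mul_assoc _ _ _

theorem map_dual_gridVec {C : ℝ → ℝ → ℝ} (hX : IsCenteredGaussianProcess P X C) (n N : ℕ)
    (L : StrongDual ℝ (Fin (N + 1) → ℝ)) :
    (P.map (gridVec X n N)).map L = gaussianReal 0 (Real.toNNReal
      (L fun i => L fun j => C (dyadicPt n (i : ℕ)) (dyadicPt n (j : ℕ)))) := by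
  rw [Measure.map_map L.continuous.measurable (measurable_gridVec hX.1 n N)]
  rw [← sum_sum_dual_pi L fun i j : Fin (N + 1) => C (dyadicPt n (i : ℕ)) (dyadicPt n (j : ℕ)),
    ← hX.2 (N + 1) (fun k => dyadicPt n k) (fun k => L (Pi.single k 1))]
  congr 1
  ext ω
  exact dual_pi_eq_sum L _

theorem isGaussian_gridVec {C : ℝ → ℝ → ℝ} (hX : IsCenteredGaussianProcess P X C) (n N : ℕ) :
    IsGaussian (P.map (gridVec X n N)) :=
  isGaussian_of_map_eq_gaussianReal fun L => ⟨_, _, map_dual_gridVec hX n N L⟩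

theorem integral_dual_gridVec {C : ℝ → ℝ → ℝ} (hX : IsCenteredGaussianProcess P X C) (n N : ℕ)
    (L : StrongDual ℝ (Fin (N + 1) → ℝ)) : ∫ x, L x ∂(P.map (gridVec X n N)) = 0 := by
  have h := integral_map (μ := P.map (gridVec X n N)) L.continuous.measurable.aemeasurable
    (f := fun y : ℝ => y) aestronglyMeasurable_id
  rw [← h, map_dual_gridVec hX n N L, integral_id_gaussianReal]

theorem integral_dual_sq_gridVec {C : ℝ → ℝ → ℝ} (hX : IsCenteredGaussianProcess P X C) (n N : ℕ)
    (L : StrongDual ℝ (Fin (N + 1) → ℝ)) : ∫ x, L x ^ 2 ∂(P.map (gridVec X n N)) =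
      Real.toNNReal (L fun i => L fun j => C (dyadicPt n (i : ℕ)) (dyadicPt n (j : ℕ))) := by
  have h := integral_map (μ := P.map (gridVec X n N)) L.continuous.measurable.aemeasurable
    (f := fun y : ℝ => y ^ 2) (by fun_prop)
  rw [← h, map_dual_gridVec hX n N L]
  have hv := variance_eq_integral (μ := gaussianReal 0 (Real.toNNReal
    (L fun i => L fun j => C (dyadicPt n (i : ℕ)) (dyadicPt n (j : ℕ)))))
    (X := fun y : ℝ => y) measurable_id.aemeasurable
  rw [variance_fun_id_gaussianReal, integral_id_gaussianReal] at hv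
  simpa using hv.symm

theorem integrable_dual_mul_dual {E : Type*} [NormedAddCommGroup E] [NormedSpace ℝ E]
    [MeasurableSpace E] [BorelSpace E] (μ : Measure E) [IsGaussian μ] (L L' : StrongDual ℝ E) :
    Integrable (fun x => L x * L' x) μ :=
  (IsGaussian.memLp_dual μ L 2 (by simp)).integrable_mul (IsGaussian.memLp_dual μ L' 2 (by simp))

theorem integral_coord_mul_coord (hX : IsCenteredGaussianProcess P X (covH (1 / 6))) (n N : ℕ)
    (a b : Fin (N + 1)) :
    ∫ x, x a * x b ∂(P.map (gridVec X n N)) =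
      covH (1 / 6) (dyadicPt n (a : ℕ)) (dyadicPt n (b : ℕ)) := by
  have := isGaussian_gridVec hX n N
  set μ := P.map (gridVec X n N)
  have e : (2 * (1 / 6) : ℝ) = 1 / 3 := by norm_num
  let π : Fin (N + 1) → StrongDual ℝ (Fin (N + 1) → ℝ) := fun k => ContinuousLinearMap.proj k
  have hcov : ∀ s t : ℝ, covH (1 / 6) s s + covH (1 / 6) t t - 2 * covH (1 / 6) s t =
      |s - t| ^ (1 / 3 : ℝ) := fun s t => by
    simp only [covH, e, sub_self, abs_zero]
    rw [Real.zero_rpow (by norm_num)]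
    ring
  have hself : ∀ s : ℝ, covH (1 / 6) s s = |s| ^ (1 / 3 : ℝ) := fun s => by
    simp only [covH, e, sub_self, abs_zero]
    rw [Real.zero_rpow (by norm_num)]
    ring
  have hsymm : ∀ s t : ℝ, covH (1 / 6) s t = covH (1 / 6) t s := fun s t => by
    simp only [covH, abs_sub_comm s t]; ring
  have hsq : ∀ k, ∫ x, x k ^ 2 ∂μ = covH (1 / 6) (dyadicPt n (k : ℕ)) (dyadicPt n (k : ℕ)) :=
    fun k => by
      refine (integral_dual_sq_gridVec hX n N (π k)).trans (Real.coe_toNNReal _ ?_)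
      show 0 ≤ covH (1 / 6) (dyadicPt n (k : ℕ)) (dyadicPt n (k : ℕ))
      rw [hself]
      positivity
  have hsub : ∫ x, (x a - x b) ^ 2 ∂μ =
      |dyadicPt n (a : ℕ) - dyadicPt n (b : ℕ)| ^ (1 / 3 : ℝ) := by
    have hq : (π a - π b) (fun i => (π a - π b) fun j =>
        covH (1 / 6) (dyadicPt n (i : ℕ)) (dyadicPt n (j : ℕ))) =
        |dyadicPt n (a : ℕ) - dyadicPt n (b : ℕ)| ^ (1 / 3 : ℝ) := by
      rw [← hcov]
      simp only [π, sub_apply, ContinuousLinearMap.proj_apply]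
      rw [hsymm (dyadicPt n (b : ℕ)) (dyadicPt n (a : ℕ))]
      ring
    refine (integral_dual_sq_gridVec hX n N (π a - π b)).trans ?_
    rw [hq, Real.coe_toNNReal _ (by positivity)]
  have hint : ∀ k l, Integrable (fun x => x k * x l) μ := fun k l =>
    integrable_dual_mul_dual μ (π k) (π l)
  have hexp : ∫ x, (x a - x b) ^ 2 ∂μ =
      (∫ x, x a ^ 2 ∂μ) + (∫ x, x b ^ 2 ∂μ) - 2 * ∫ x, x a * x b ∂μ := by
    rw [← integral_const_mul, ← integral_add, ← integral_sub]
    · congr 1 with x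
      ring
    · exact (by simpa only [sq] using hint a a : Integrable (fun x => x a ^ 2) μ).add
        (by simpa only [sq] using hint b b : Integrable (fun x => x b ^ 2) μ)
    · exact (hint a b).const_mul 2
    · simpa only [sq] using hint a a
    · simpa only [sq] using hint b b
  rw [hsub, hsq, hsq, ← hcov] at hexp
  linarith

theorem integral_gridCoord_mul_gridCoord (hX : IsCenteredGaussianProcess P X (covH (1 / 6)))
    (n : ℕ) {N k l : ℕ} (hk : k ≤ N) (hl : l ≤ N) :
    ∫ x, gridCoord N k x * gridCoord N l x ∂(P.map (gridVec X n N)) =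
      stepVar n * covH (1 / 6) k l := by
  have h1 : k % (N + 1) = k := Nat.mod_eq_of_lt (by omega)
  have h2 : l % (N + 1) = l := Nat.mod_eq_of_lt (by omega)
  refine (integral_coord_mul_coord hX n N (Fin.ofNat (N + 1) k) (Fin.ofNat (N + 1) l)).trans ?_
  simp only [Fin.val_ofNat, h1, h2, dyadicPt]
  exact covH_mul_right (by positivity) _ _

theorem integral_gridIncr_mul_gridCoord (hX : IsCenteredGaussianProcess P X (covH (1 / 6)))
    (n : ℕ) {N i k : ℕ} (hi : i < N) (hk : k ≤ N) :
    ∫ x, gridIncr N i x * gridCoord N k x ∂(P.map (gridVec X n N)) =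
      stepVar n * covIncr i k := by
  have := isGaussian_gridVec hX n N
  simp only [gridIncr, sub_apply, sub_mul]
  rw [integral_sub (integrable_dual_mul_dual _ _ _) (integrable_dual_mul_dual _ _ _),
    integral_gridCoord_mul_gridCoord hX n (show i + 1 ≤ N from hi) hk,
    integral_gridCoord_mul_gridCoord hX n hi.le hk, covIncr]
  push_cast
  ring

theorem integral_gridIncr_mul_gridIncr (hX : IsCenteredGaussianProcess P X (covH (1 / 6)))
    (n : ℕ) {N i j : ℕ} (hi : i < N) (hj : j < N) :
    ∫ x, gridIncr N i x * gridIncr N j x ∂(P.map (gridVec X n N)) =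
      stepVar n * covIncrIncr i j := by
  have := isGaussian_gridVec hX n N
  conv_lhs => enter [2, x]; rw [gridIncr.eq_def N j, sub_apply, mul_sub]
  rw [integral_sub (integrable_dual_mul_dual _ _ _) (integrable_dual_mul_dual _ _ _),
    integral_gridIncr_mul_gridCoord hX n hi (show j + 1 ≤ N from hj),
    integral_gridIncr_mul_gridCoord hX n hi hj.le, covIncrIncr]
  ring

theorem integral_gridIncr_mul_gridMid (hX : IsCenteredGaussianProcess P X (covH (1 / 6)))
    (n : ℕ) {N i j : ℕ} (hi : i < N) (hj : j < N) :
    ∫ x, gridIncr N i x * gridMid N j x ∂(P.map (gridVec X n N)) =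
      stepVar n * covIncrMid i j := by
  have := isGaussian_gridVec hX n N
  have e : ∀ x, gridIncr N i x * gridMid N j x =
      2⁻¹ * (gridIncr N i x * gridCoord N (j + 1) x + gridIncr N i x * gridCoord N j x) := by
    intro x
    simp only [gridMid, smul_apply, add_apply, smul_eq_mul]
    ring
  simp only [e]
  rw [integral_const_mul,
    integral_add (integrable_dual_mul_dual _ _ _) (integrable_dual_mul_dual _ _ _),
    integral_gridIncr_mul_gridCoord hX n hi (show j + 1 ≤ N from hj),
    integral_gridIncr_mul_gridCoord hX n hi hj.le, covIncrMid]
  ring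

/-- The vector of the covariances of the functional `ℓ` with the coordinates. -/
def covVec {m : ℕ} (μ : Measure (Fin m → ℝ)) (ℓ : StrongDual ℝ (Fin m → ℝ)) : Fin m → ℝ :=
  fun k => ∫ x, ℓ x * x k ∂μ

theorem dual_covVec {m : ℕ} (μ : Measure (Fin m → ℝ)) [IsGaussian μ]
    (ℓ L : StrongDual ℝ (Fin m → ℝ)) : L (covVec μ ℓ) = ∫ x, ℓ x * L x ∂μ := by
  have e : ∀ x, ℓ x * L x = ∑ k, L (Pi.single k 1) * (ℓ x * x k) := fun x => by
    rw [dual_pi_eq_sum L x, Finset.mul_sum]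
    exact Finset.sum_congr rfl fun k _ => by ring
  have hint : ∀ k ∈ Finset.univ, Integrable (fun x => L (Pi.single k 1) * (ℓ x * x k)) μ :=
    fun k _ => (integrable_dual_mul_dual μ ℓ (ContinuousLinearMap.proj k)).const_mul _
  simp only [e]
  rw [integral_finsetSum _ hint, dual_pi_eq_sum L]
  exact Finset.sum_congr rfl fun k _ => (integral_const_mul _ _).symm

end ProcessLaw

section Conditional

theorem matchingSum_mono {p : Fin 4 → Fin 4 → ℝ} {Q Q' : Fin 4 → ℝ} (hp : ∀ a b, 0 ≤ p a b)
    (hQ : ∀ a, 0 ≤ Q a) (h : ∀ a, Q a ≤ Q' a) : matchingSum p Q ≤ matchingSum p Q' := by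
  have hQ' : ∀ a, 0 ≤ Q' a := fun a => (hQ a).trans (h a)
  unfold matchingSum
  gcongr <;> first | exact hp _ _ | exact hQ _ | exact hQ' _ | exact h _ |
    exact mul_nonneg (hQ _) (hQ _) | exact mul_nonneg (hQ' _) (hQ' _)

/-- The weighted count of matchings for the increments and midpoints over four grid steps. -/
def stepMatching (n : ℕ) (i : Fin 4 → ℕ) : ℝ :=
  matchingSum (fun a b => stepVar n * |covIncrIncr (i a) (i b)|)
    (fun a => ∑ b, stepVar n * |covIncrMid (i a) (i b)|)

variable [MeasurableSpace Ω] {P : Measure Ω} {X : ℝ → Ω → ℝ}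

theorem abs_integral_gridIncr_le (hX : IsCenteredGaussianProcess P X (covH (1 / 6)))
    (n : ℕ) {N : ℕ} {i : Fin 4 → ℕ} (hi : ∀ a, i a < N) {φ : (Fin 4 → ℝ) → ℝ} (hφ : CbSmooth φ)
    {K : ℝ} (hK0 : ∀ x, ‖iteratedFDeriv ℝ 0 φ x‖ ≤ K) (hK2 : ∀ x, ‖iteratedFDeriv ℝ 2 φ x‖ ≤ K)
    (hK4 : ∀ x, ‖iteratedFDeriv ℝ 4 φ x‖ ≤ K) :
    |∫ x, gridIncr N (i 0) x * (gridIncr N (i 1) x * (gridIncr N (i 2) x * (gridIncr N (i 3) x *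
      φ (fun b => gridMid N (i b) x)))) ∂(P.map (gridVec X n N))| ≤ K * stepMatching n i := by
  have := isGaussian_gridVec hX n N
  set μ := P.map (gridVec X n N)
  have hv := stepVar_pos n
  have hcov : ∀ a, IsCovVec μ (gridIncr N (i a)) (covVec μ (gridIncr N (i a))) := fun a => by
    refine ⟨fun L => dual_covVec μ _ L, ?_⟩
    rw [dual_covVec, integral_gridIncr_mul_gridIncr hX n (hi a) (hi a), covIncrIncr_self, mul_one]
    exact hv
  refine (abs_integral_four_mul_smooth_le (integral_dual_gridVec hX n N) hcov
    (ContinuousLinearMap.pi fun b => gridMid N (i b)) hφ hK0 hK2 hK4).trans ?_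
  have hK : 0 ≤ K := (norm_nonneg _).trans (hK0 0)
  refine mul_le_mul_of_nonneg_left ?_ hK
  have hp : ∀ a b, |gridIncr N (i b) (covVec μ (gridIncr N (i a)))| =
      stepVar n * |covIncrIncr (i a) (i b)| := fun a b => by
    rw [dual_covVec, integral_gridIncr_mul_gridIncr hX n (hi a) (hi b), abs_mul, abs_of_pos hv]
  simp only [hp]
  refine matchingSum_mono (fun a b => by positivity) (fun a => norm_nonneg _) fun a => ?_
  refine (pi_norm_le_iff_of_nonneg (Finset.sum_nonneg fun b _ => by positivity)).2 fun b => ?_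
  change ‖gridMid N (i b) (covVec μ (gridIncr N (i a)))‖ ≤ _
  rw [dual_covVec, integral_gridIncr_mul_gridMid hX n (hi a) (hi b),
    Real.norm_eq_abs, abs_mul, abs_of_pos hv]
  exact Finset.single_le_sum (f := fun b => stepVar n * |covIncrMid (i a) (i b)|)
    (fun b _ => by positivity) (Finset.mem_univ b)

theorem integral_gridIncr_pow_eight (hX : IsCenteredGaussianProcess P X (covH (1 / 6)))
    (n : ℕ) {N i : ℕ} (hi : i < N) :
    ∫ x, gridIncr N i x ^ 8 ∂(P.map (gridVec X n N)) =
      stepVar n ^ 4 * ∫ x, x ^ 8 ∂gaussianReal 0 1 := by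
  have hsq := integral_dual_sq_gridVec hX n N (gridIncr N i)
  simp only [sq] at hsq
  rw [integral_gridIncr_mul_gridIncr hX n hi hi, covIncrIncr_self, mul_one] at hsq
  have hlaw := map_dual_gridVec hX n N (gridIncr N i)
  have hscale := gaussianReal_map_const_mul (μ := 0) (v := 1) (√(stepVar n))
  rw [← integral_map (μ := P.map (gridVec X n N)) (gridIncr N i).continuous.measurable.aemeasurable
    (f := fun y : ℝ => y ^ 8) (by fun_prop), hlaw]
  have hvar : Real.toNNReal (gridIncr N i fun k => gridIncr N i fun l =>
      covH (1 / 6) (dyadicPt n (k : ℕ)) (dyadicPt n (l : ℕ))) = NNReal.mk (√(stepVar n) ^ 2) (sq_nonneg _) := by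
    ext
    rw [← hsq]
    exact (Real.sq_sqrt (stepVar_pos n).le).symm
  rw [hvar]
  rw [mul_zero, mul_one] at hscale
  rw [← hscale, integral_map (by fun_prop) (by fun_prop), ← integral_const_mul]
  congr 1 with x
  rw [mul_pow, show √(stepVar n) ^ 8 = (√(stepVar n) ^ 2) ^ 4 by ring,
    Real.sq_sqrt (stepVar_pos n).le]

theorem integrable_dual_pow_eight {E : Type*} [NormedAddCommGroup E] [NormedSpace ℝ E]
    [MeasurableSpace E] [BorelSpace E] (μ : Measure E) [IsGaussian μ] (L : StrongDual ℝ E) :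
    Integrable (fun x => L x ^ 8) μ := by
  have h := (IsGaussian.memLp_dual μ L (8 : ℕ) (by simp)).integrable_norm_pow'
  refine h.congr (ae_of_all _ fun x => ?_)
  exact Even.pow_abs (by decide) (L x)

theorem abs_prod_four_le (a b c d : ℝ) :
    |a * b * (c * d)| ≤ (a ^ 4 + b ^ 4 + c ^ 4 + d ^ 4) / 4 := by
  rw [abs_le]
  constructor <;>
    nlinarith [sq_nonneg (a * b + c * d), sq_nonneg (a * b - c * d), sq_nonneg (a ^ 2 - b ^ 2),
      sq_nonneg (c ^ 2 - d ^ 2)]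

theorem sq_sub_pow_four_le {c : ℝ} (hc : 0 ≤ c) (u : ℝ) : (u ^ 2 - c) ^ 4 ≤ u ^ 8 + c ^ 4 := by
  have h : (u ^ 2 - c) ^ 2 ≤ u ^ 4 + c ^ 2 := by nlinarith [sq_nonneg u]
  have := pow_le_pow_left₀ (sq_nonneg _) h 2
  nlinarith [sq_nonneg (u ^ 4 - c ^ 2)]

/-- The product of the second order factors of the summands. -/
def sqFactor (N : ℕ) (c : ℝ) (i : Fin 4 → ℕ) (z : Fin (N + 1) → ℝ) : ℝ :=
  (gridIncr N (i 0) z ^ 2 - c) * (gridIncr N (i 1) z ^ 2 - c) *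
    ((gridIncr N (i 2) z ^ 2 - c) * (gridIncr N (i 3) z ^ 2 - c))

theorem abs_sqFactor_le {N : ℕ} {c : ℝ} (hc : 0 ≤ c) (i : Fin 4 → ℕ) (z : Fin (N + 1) → ℝ) :
    |sqFactor N c i z| ≤ ∑ a, (gridIncr N (i a) z ^ 8 + c ^ 4) := by
  have hn : ∀ a, 0 ≤ gridIncr N (i a) z ^ 8 + c ^ 4 := fun a => by positivity
  refine (abs_prod_four_le _ _ _ _).trans ?_
  rw [Fin.sum_univ_four]
  linarith [sq_sub_pow_four_le hc (gridIncr N (i 0) z), sq_sub_pow_four_le hc (gridIncr N (i 1) z),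
    sq_sub_pow_four_le hc (gridIncr N (i 2) z), sq_sub_pow_four_le hc (gridIncr N (i 3) z),
    hn 0, hn 1, hn 2, hn 3]

/-- The eighth moment of the standard Gaussian distribution. -/
def gaussianMomentEight : ℝ := ∫ x, x ^ 8 ∂gaussianReal 0 1

theorem gaussianMomentEight_nonneg : 0 ≤ gaussianMomentEight :=
  integral_nonneg fun x => Even.pow_nonneg (by decide) x

theorem integrable_sum_gridIncr_pow_eight (hX : IsCenteredGaussianProcess P X (covH (1 / 6)))
    (n N : ℕ) (i : Fin 4 → ℕ) (c : ℝ) :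
    Integrable (fun z => ∑ a, (gridIncr N (i a) z ^ 8 + c ^ 4)) (P.map (gridVec X n N)) := by
  have := isGaussian_gridVec hX n N
  exact integrable_finsetSum _ fun a _ =>
    (integrable_dual_pow_eight _ (gridIncr N (i a))).add (integrable_const _)

theorem integral_sum_gridIncr_pow_eight_le (hX : IsCenteredGaussianProcess P X (covH (1 / 6)))
    {n N : ℕ} {i : Fin 4 → ℕ} (hi : ∀ a, i a < N) {c : ℝ} (hc : 0 ≤ c) (hcv : c ≤ stepVar n) :
    ∫ z, ∑ a, (gridIncr N (i a) z ^ 8 + c ^ 4) ∂(P.map (gridVec X n N)) ≤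
      4 * (gaussianMomentEight + 1) * stepVar n ^ 4 := by
  have := isGaussian_gridVec hX n N
  have hint : ∀ a ∈ Finset.univ, Integrable (fun z => gridIncr N (i a) z ^ 8 + c ^ 4)
      (P.map (gridVec X n N)) := fun a _ =>
    (integrable_dual_pow_eight _ (gridIncr N (i a))).add (integrable_const _)
  rw [integral_finsetSum _ hint]
  have h : ∀ a, ∫ z, (gridIncr N (i a) z ^ 8 + c ^ 4) ∂(P.map (gridVec X n N)) =
      stepVar n ^ 4 * gaussianMomentEight + c ^ 4 := fun a => by
    rw [integral_add (integrable_dual_pow_eight _ (gridIncr N (i a))) (integrable_const _),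
      integral_gridIncr_pow_eight hX n (hi a), gaussianMomentEight]
    simp
  simp only [h]
  rw [Finset.sum_const, Finset.card_univ, Fintype.card_fin, nsmul_eq_mul]
  push_cast
  linarith [pow_le_pow_left₀ hc hcv 4]

/-- If the integrand splits over two independent components, the integral is bounded by the
product of a bound for the first and a uniform bound for the second factor. -/
theorem abs_integral_prod_mul_le {E F : Type*} [MeasurableSpace E] [MeasurableSpace F]
    {μ : Measure E} {ν : Measure F} [SFinite μ] [SFinite ν] {W B : F → ℝ} {g : E → F → ℝ} {M : ℝ}
    (hW : ∀ z, |W z| ≤ B z) (hB : Integrable B ν) (hg : ∀ z, |∫ x, g x z ∂μ| ≤ M) :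
    |∫ w, W w.2 * g w.1 w.2 ∂(μ.prod ν)| ≤ (∫ z, B z ∂ν) * M := by
  have hbound : ∀ z, |W z * ∫ x, g x z ∂μ| ≤ B z * M := fun z => by
    rw [abs_mul]
    exact mul_le_mul (hW z) (hg z) (abs_nonneg _) ((abs_nonneg _).trans (hW z))
  by_cases hint : Integrable (fun w : E × F => W w.2 * g w.1 w.2) (μ.prod ν)
  · rw [integral_prod_symm _ hint, ← integral_mul_const, ← Real.norm_eq_abs]
    refine norm_integral_le_of_norm_le (hB.mul_const M) (ae_of_all _ fun z => ?_)
    simpa only [integral_const_mul, Real.norm_eq_abs] using hbound z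
  · rw [integral_undef hint, abs_zero, ← integral_mul_const]
    exact integral_nonneg fun z => (abs_nonneg _).trans (hbound z)

theorem IndepProcesses.indepFun_gridVec {X1 X2 : ℝ → Ω → ℝ} (h : IndepProcesses P X1 X2)
    (n N : ℕ) : IndepFun (gridVec X1 n N) (gridVec X2 n N) P := by
  have hle : ∀ X : ℝ → Ω → ℝ, MeasurableSpace.comap (gridVec X n N) inferInstance ≤
      ⨆ t : ℝ, MeasurableSpace.comap (X t) inferInstance := fun X => by
    rw [← measurable_iff_comap_le]
    refine @measurable_pi_lambda _ _ _ (⨆ t : ℝ, MeasurableSpace.comap (X t) inferInstance) _ _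
      fun k => ?_
    rw [measurable_iff_comap_le]
    exact le_iSup (fun t => MeasurableSpace.comap (X t) inferInstance) (dyadicPt n k)
  rw [IndepFun_iff_Indep]
  exact indep_of_indep_of_le_left (indep_of_indep_of_le_right h (hle X2)) (hle X1)

end Conditional

section Assembly

theorem stepVar_pow_three (n : ℕ) : stepVar n ^ 3 = (2 : ℝ) ^ (-(n : ℝ) / 2) := by
  rw [stepVar, ← Real.rpow_natCast, ← Real.rpow_mul (by positivity)]
  norm_num

theorem two_rpow_le_stepVar (n : ℕ) : (2 : ℝ) ^ (-(n : ℝ) / 3) ≤ stepVar n := by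
  rw [stepVar, ← Real.rpow_mul (by norm_num)]
  refine Real.rpow_le_rpow_of_exponent_le (by norm_num) ?_
  have : (0 : ℝ) ≤ n := n.cast_nonneg
  linarith

theorem stepVar_pow_three_mul_nSteps_le {t : ℝ} (ht : 0 ≤ t) (n : ℕ) :
    stepVar n ^ 3 * nSteps n t ≤ t := by
  have h : (nSteps n t : ℝ) ≤ (2 : ℝ) ^ ((n : ℝ) / 2) * t := Nat.floor_le (by positivity)
  have h1 : (2 : ℝ) ^ (-(n : ℝ) / 2) * (2 : ℝ) ^ ((n : ℝ) / 2) = 1 := by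
    rw [← Real.rpow_add (by norm_num), neg_div, neg_add_cancel, Real.rpow_zero]
  rw [stepVar_pow_three]
  calc (2 : ℝ) ^ (-(n : ℝ) / 2) * nSteps n t
      ≤ (2 : ℝ) ^ (-(n : ℝ) / 2) * ((2 : ℝ) ^ ((n : ℝ) / 2) * t) := by gcongr
    _ = t := by rw [← mul_assoc, h1, one_mul]

theorem sum4_stepMatching_le (n N : ℕ) :
    sum4 N (fun i j k l => stepMatching n ![i, j, k, l]) ≤
      (N * stepVar n) ^ 2 * (12 + 288 * (stepVar n * (N : ℝ) ^ (1 / 3 : ℝ)) +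
        576 * (stepVar n * (N : ℝ) ^ (1 / 3 : ℝ)) ^ 2) := by
  have hv := stepVar_pos n
  refine (sum4_matchingSum_le (N := N) (p := fun i j => stepVar n * |covIncrIncr i j|)
    (q := fun i j => stepVar n * |covIncrMid i j|) (A := stepVar n * 2) (v := stepVar n)
    (R := stepVar n * (3 / 2 * (N : ℝ) ^ (1 / 3 : ℝ)))
    (fun i j => by positivity) (fun i j => by positivity) (fun i _ => ?_) (fun i _ j _ => ?_)
    (fun j hj => ?_) ?_).trans_eq (by ring)
  · rw [← Finset.mul_sum]
    exact mul_le_mul_of_nonneg_left (sum_abs_covIncrIncr_le N i) hv.le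
  · exact mul_le_of_le_one_right hv.le (abs_covIncrMid_le_one i j)
  · rw [← Finset.mul_sum]
    exact mul_le_mul_of_nonneg_left (sum_abs_covIncrMid_le hj) hv.le
  · rw [← Finset.mul_sum]
    exact mul_le_mul_of_nonneg_left (sum_abs_covIncrMid_self_le N) hv.le

theorem stepVar_pow_mul_sum4_le {t : ℝ} (ht : 0 ≤ t) (n : ℕ) :
    stepVar n ^ 4 * sum4 (nSteps n t) (fun i j k l => stepMatching n ![i, j, k, l]) ≤
      1440 * (t ^ 2 + t ^ 3 + t ^ 4) := by
  have hv := stepVar_pos n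
  have hNt := stepVar_pow_three_mul_nSteps_le ht n
  set N := nSteps n t
  set s := stepVar n * (N : ℝ) ^ (1 / 3 : ℝ) with hs
  have hs0 : 0 ≤ s := by positivity
  have hs3 : s ^ 3 ≤ t := by
    rw [hs, mul_pow, ← Real.rpow_natCast ((N : ℝ) ^ (1 / 3 : ℝ)), ← Real.rpow_mul (by positivity)]
    norm_num
    exact hNt
  have hst : s ≤ 1 + t := by nlinarith [mul_nonneg hs0 (sq_nonneg (s - 1))]
  have hs2 : s ^ 2 ≤ (1 + t) ^ 2 := pow_le_pow_left₀ hs0 hst 2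
  have hN2 : (stepVar n ^ 3 * N) ^ 2 ≤ t ^ 2 := pow_le_pow_left₀ (by positivity) hNt 2
  calc stepVar n ^ 4 * sum4 N (fun i j k l => stepMatching n ![i, j, k, l])
      ≤ stepVar n ^ 4 * ((N * stepVar n) ^ 2 * (12 + 288 * s + 576 * s ^ 2)) := by
        gcongr
        exact sum4_stepMatching_le n N
    _ = (stepVar n ^ 3 * N) ^ 2 * (12 + 288 * s + 576 * s ^ 2) := by ring
    _ ≤ t ^ 2 * (12 + 288 * (1 + t) + 576 * (1 + t) ^ 2) := by gcongr
    _ ≤ 1440 * (t ^ 2 + t ^ 3 + t ^ 4) := by nlinarith [sq_nonneg t, sq_nonneg (t ^ 2)]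

theorem CbSmooth2.cbSmooth_coord {ι : Type*} [Fintype ι] {f : ℝ → ℝ → ℝ} (hf : CbSmooth2 f)
    (b : ι) : CbSmooth fun w : (ι → ℝ) × (ι → ℝ) => f (w.1 b) (w.2 b) :=
  CbSmooth.comp_clm hf
    (((ContinuousLinearMap.proj b : (ι → ℝ) →L[ℝ] ℝ).comp (ContinuousLinearMap.fst ℝ _ _)).prod
      ((ContinuousLinearMap.proj b : (ι → ℝ) →L[ℝ] ℝ).comp (ContinuousLinearMap.snd ℝ _ _)))

theorem exists_summand_bound {Ω : Type*} [MeasurableSpace Ω] {P : Measure Ω}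
    [IsProbabilityMeasure P] {X1 X2 : ℝ → Ω → ℝ}
    (hX1 : IsCenteredGaussianProcess P X1 (covH (1 / 6)))
    (hX2 : IsCenteredGaussianProcess P X2 (covH (1 / 6)))
    (hInd : IndepProcesses P X1 X2) {f1 f2 f3 f4 : ℝ → ℝ → ℝ}
    (hf1 : CbSmooth2 f1) (hf2 : CbSmooth2 f2) (hf3 : CbSmooth2 f3) (hf4 : CbSmooth2 f4) :
    ∃ K : ℝ, 0 ≤ K ∧ ∀ (n N : ℕ) (i : Fin 4 → ℕ), (∀ a, i a < N) →
      |∫ ω, ((Xmid X1 X2 f1 n (i 0) ω *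
          (Xincr X1 n (i 0) ω * (Xincr X2 n (i 0) ω ^ 2 - (2 : ℝ) ^ (-(n : ℝ) / 3)))) *
        (Xmid X1 X2 f2 n (i 1) ω *
          (Xincr X1 n (i 1) ω * (Xincr X2 n (i 1) ω ^ 2 - (2 : ℝ) ^ (-(n : ℝ) / 3)))) *
        (Xmid X1 X2 f3 n (i 2) ω *
          (Xincr X1 n (i 2) ω * (Xincr X2 n (i 2) ω ^ 2 - (2 : ℝ) ^ (-(n : ℝ) / 3)))) *
        (Xmid X1 X2 f4 n (i 3) ω *
          (Xincr X1 n (i 3) ω * (Xincr X2 n (i 3) ω ^ 2 - (2 : ℝ) ^ (-(n : ℝ) / 3))))) ∂P| ≤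
      K * stepVar n ^ 4 * stepMatching n i := by
  set φ : (Fin 4 → ℝ) × (Fin 4 → ℝ) → ℝ := fun w =>
    f1 (w.1 0) (w.2 0) * f2 (w.1 1) (w.2 1) * (f3 (w.1 2) (w.2 2) * f4 (w.1 3) (w.2 3)) with hφdef
  have hφ : CbSmooth φ := ((hf1.cbSmooth_coord 0).mul (hf2.cbSmooth_coord 1)).mul
    ((hf3.cbSmooth_coord 2).mul (hf4.cbSmooth_coord 3))
  obtain ⟨K0, hK0⟩ := hφ.exists_uniform_bound 0
  obtain ⟨K2, hK2⟩ := hφ.exists_uniform_bound 2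
  obtain ⟨K4, hK4⟩ := hφ.exists_uniform_bound 4
  set K := max K0 (max K2 K4) with hKdef
  have hK : 0 ≤ K := ((norm_nonneg _).trans (hK0 0 0)).trans (le_max_left _ _)
  refine ⟨4 * (gaussianMomentEight + 1) * K,
    mul_nonneg (by linarith [gaussianMomentEight_nonneg]) hK, fun n N i hi => ?_⟩
  set c := (2 : ℝ) ^ (-(n : ℝ) / 3) with hc
  have hc0 : 0 ≤ c := by positivity
  have := isGaussian_gridVec hX1 n N
  have := isGaussian_gridVec hX2 n N
  have hm1 := measurable_gridVec hX1.1 n N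
  have hm2 := measurable_gridVec hX2.1 n N
  set g : (Fin (N + 1) → ℝ) → (Fin (N + 1) → ℝ) → ℝ := fun x z =>
    gridIncr N (i 0) x * (gridIncr N (i 1) x * (gridIncr N (i 2) x * (gridIncr N (i 3) x *
      φ (fun b => gridMid N (i b) x, fun b => gridMid N (i b) z)))) with hg
  have hlaw := (hInd.indepFun_gridVec n N).map_prod_eq_prod_map_map
    hm1.aemeasurable hm2.aemeasurable
  have hcont : Continuous fun w : (Fin (N + 1) → ℝ) × (Fin (N + 1) → ℝ) =>
      sqFactor N c i w.2 * g w.1 w.2 := by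
    have := hφ.continuous
    simp only [hg, sqFactor]
    fun_prop
  have hint : ∫ w, sqFactor N c i w.2 * g w.1 w.2
      ∂((P.map (gridVec X1 n N)).prod (P.map (gridVec X2 n N))) =
      ∫ ω, sqFactor N c i (gridVec X2 n N ω) * g (gridVec X1 n N ω) (gridVec X2 n N ω) ∂P := by
    rw [← hlaw, integral_map (hm1.prodMk hm2).aemeasurable hcont.aestronglyMeasurable]
  have hcond : ∀ z, |∫ x, g x z ∂(P.map (gridVec X1 n N))| ≤ K * stepMatching n i := fun z =>
    abs_integral_gridIncr_le hX1 n hi (hφ.comp_prodMk fun b => gridMid N (i b) z)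
      (fun x => (hK0 _ x).trans (le_max_left _ _))
      (fun x => (hK2 _ x).trans ((le_max_left _ _).trans (le_max_right _ _)))
      (fun x => (hK4 _ x).trans ((le_max_right _ _).trans (le_max_right _ _)))
  have hprod := abs_integral_prod_mul_le (abs_sqFactor_le hc0 i)
    (integrable_sum_gridIncr_pow_eight hX2 n N i c) hcond
  rw [hint] at hprod
  have hmoment := integral_sum_gridIncr_pow_eight_le hX2 hi hc0 (two_rpow_le_stepVar n)
  have hM : 0 ≤ K * stepMatching n i := (abs_nonneg _).trans (hcond 0)
  refine le_trans (le_of_eq ?_) (hprod.trans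
    ((mul_le_mul_of_nonneg_right hmoment hM).trans_eq (by ring)))
  congr 2 with ω
  simp only [hg, hφdef, sqFactor, gridIncr_gridVec _ n (hi _), gridMid_gridVec _ n (hi _), Xmid]
  ring

end Assembly

theorem mixed_chaos_moment_bound_full_sum
    {Ω : Type*} [MeasurableSpace Ω] (P : Measure Ω) [IsProbabilityMeasure P]
    (X1 X2 : ℝ → Ω → ℝ)
    (hX1 : IsCenteredGaussianProcess P X1 (covH (1 / 6)))
    (hX2 : IsCenteredGaussianProcess P X2 (covH (1 / 6)))
    (hInd : IndepProcesses P X1 X2)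
    (f1 f2 f3 f4 : ℝ → ℝ → ℝ)
    (hf1 : CbSmooth2 f1) (hf2 : CbSmooth2 f2) (hf3 : CbSmooth2 f3) (hf4 : CbSmooth2 f4) :
    ∃ C : ℝ, 0 < C ∧ ∀ t : ℝ, 0 ≤ t → ∀ n : ℕ, 1 ≤ n →
      (∑ i1 ∈ Finset.range (nSteps n t), ∑ i2 ∈ Finset.range (nSteps n t),
        ∑ i3 ∈ Finset.range (nSteps n t), ∑ i4 ∈ Finset.range (nSteps n t),
          abs (∫ ω,
            ((Xmid X1 X2 f1 n i1 ω *
                (Xincr X1 n i1 ω * (Xincr X2 n i1 ω ^ 2 - (2 : ℝ) ^ (-(n : ℝ) / 3)))) *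
              (Xmid X1 X2 f2 n i2 ω *
                (Xincr X1 n i2 ω * (Xincr X2 n i2 ω ^ 2 - (2 : ℝ) ^ (-(n : ℝ) / 3)))) *
              (Xmid X1 X2 f3 n i3 ω *
                (Xincr X1 n i3 ω * (Xincr X2 n i3 ω ^ 2 - (2 : ℝ) ^ (-(n : ℝ) / 3)))) *
              (Xmid X1 X2 f4 n i4 ω *
                (Xincr X1 n i4 ω * (Xincr X2 n i4 ω ^ 2 - (2 : ℝ) ^ (-(n : ℝ) / 3))))) ∂P)) ≤
        C * (t + t ^ 2 + t ^ 3 + t ^ 4) := by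
  obtain ⟨K, hK, hbound⟩ := exists_summand_bound hX1 hX2 hInd hf1 hf2 hf3 hf4
  refine ⟨1440 * K + 1, by positivity, fun t ht n _ => ?_⟩
  set N := nSteps n t
  have hsum : sum4 N (fun i j k l => K * stepVar n ^ 4 * stepMatching n ![i, j, k, l]) ≤
      (1440 * K + 1) * (t + t ^ 2 + t ^ 3 + t ^ 4) := by
    rw [sum4_const_mul]
    have h := mul_le_mul_of_nonneg_left (stepVar_pow_mul_sum4_le ht n) hK
    have ht2 := pow_nonneg ht 2
    have ht3 := pow_nonneg ht 3
    have ht4 := pow_nonneg ht 4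
    nlinarith [mul_nonneg hK ht]
  refine le_trans ?_ hsum
  refine Finset.sum_le_sum fun i1 h1 => Finset.sum_le_sum fun i2 h2 =>
    Finset.sum_le_sum fun i3 h3 => Finset.sum_le_sum fun i4 h4 => ?_
  refine hbound n N ![i1, i2, i3, i4] fun a => ?_
  fin_cases a
  · exact Finset.mem_range.1 h1
  · exact Finset.mem_range.1 h2
  · exact Finset.mem_range.1 h3
  · exact Finset.mem_range.1 h4

end
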